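/- arXiv:1809.03034 — 2 statements merged into one kernel-verified Lean document; each statement's English description precedes it below -/
import Mathlib

section
/- Let u ∈ L^p(T^d), p ∈ (1,∞). (i) If s ∈ (0, 1/2) and Du ∈ L^p(T^d), then for every δ > 0 there exists C(δ) > 0, depending on δ, d, s, p, such that ‖(−Δ)^s u‖_{L^p(T^d)} ≤ δ‖Du‖_{L^p(T^d)} + C(δ)‖u‖_{L^p(T^d)}. (ii) If s ∈ [1/2, 1) and D²u ∈ L^p(T^d), then for every δ > 0 there exists C(δ) > 0, depending on δ, d, s, p, such that ‖(−Δ)^s u‖_{L^p(T^d)} ≤ δ‖D²u‖_{L^p(T^d)} + C(δ)‖u‖_{L^p(T^d)}. -/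
open MeasureTheory Real Set Filter
open scoped Topology

noncomputable section

/-- Points of `ℝ^d`; `ℤ^d`-periodic functions on it represent functions on the
flat torus `𝕋^d = ℝ^d/ℤ^d`. -/
abbrev Pt (d : ℕ) := Fin d → ℝ

namespace FracMFG

variable {d : ℕ}

/-- The Euclidean distance on `ℝ^d`. -/
def edist' (x y : Pt d) : ℝ := Real.sqrt (∑ i, (x i - y i) ^ 2)

/-- The Euclidean norm on `ℝ^d`. -/
def vnorm (x : Pt d) : ℝ := Real.sqrt (∑ i, (x i) ^ 2)

/-- The Euclidean norm of an integer frequency vector. -/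
def normZ (k : Fin d → ℤ) : ℝ := Real.sqrt (∑ i, ((k i : ℝ)) ^ 2)

/-- Euclidean dot product. -/
def dotP (a b : Pt d) : ℝ := ∑ i, a i * b i

/-- `ℤ^d`-periodicity: such functions are identified with functions on the torus. -/
def IsPeriodicF {α : Type*} (u : Pt d → α) : Prop :=
  ∀ (k : Fin d → ℤ) (x : Pt d), u (fun i => x i + (k i : ℝ)) = u x

/-- The fundamental domain `[0,1)^d` of the torus. -/
def torusBox (d : ℕ) : Set (Pt d) := Set.univ.pi fun _ : Fin d => Set.Ico (0:ℝ) 1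

/-- The Fourier character `e^{2π i k·x}`. -/
def fChar (k : Fin d → ℤ) (x : Pt d) : ℂ :=
  Complex.exp (2 * (π : ℂ) * Complex.I * ((∑ i, (k i : ℝ) * x i : ℝ) : ℂ))

/-- The `k`-th Fourier coefficient of a function on the torus. -/
def fCoeff (u : Pt d → ℝ) (k : Fin d → ℤ) : ℂ :=
  ∫ x in torusBox d, (u x : ℂ) * fChar (-k) x

/-- The fractional Laplacian `(-Δ)^s` on the torus, defined via the multiple Fourier
series `(-Δ)^s u(x) = (2π)^{2s} ∑_k |k|^{2s} û(k) e^{2πik·x}`. -/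
def fracLap (s : ℝ) (u : Pt d → ℝ) (x : Pt d) : ℝ :=
  ((((2*π) ^ (2*s) : ℝ) : ℂ) *
    ∑' k : Fin d → ℤ, ((normZ k ^ (2*s) : ℝ) : ℂ) * fCoeff u k * fChar k x).re

/-- The Bessel potential operator `(I-Δ)^{μ/2}` on the torus. -/
def besselOp (μ : ℝ) (u : Pt d → ℝ) (x : Pt d) : ℝ :=
  (∑' k : Fin d → ℤ,
    (((1 + 4 * π ^ 2 * normZ k ^ 2) ^ (μ / 2) : ℝ) : ℂ) * fCoeff u k * fChar k x).re

/-- The fractional heat semigroup `T_t = e^{-t(-Δ)^s}` on the torus. -/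
def heatSG (s t : ℝ) (u : Pt d → ℝ) (x : Pt d) : ℝ :=
  (∑' k : Fin d → ℤ,
    ((Real.exp (-(t * (2 * π * normZ k) ^ (2*s))) : ℝ) : ℂ) * fCoeff u k * fChar k x).re

/-- `L^p` norm on the torus (finite `p`). -/
def lpNorm (p : ℝ) (u : Pt d → ℝ) : ℝ :=
  (∫ x in torusBox d, |u x| ^ p) ^ (1 / p)

/-- The Bessel potential norm `‖u‖_{μ,p} = ‖(I-Δ)^{μ/2}u‖_{L^p(𝕋^d)}`. -/
def besselNorm (μ p : ℝ) (u : Pt d → ℝ) : ℝ := lpNorm p (besselOp μ u)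

/-- sup-norm on the torus. -/
def supNorm (u : Pt d → ℝ) : ℝ := sSup {r | ∃ x : Pt d, r = |u x|}

/-- Hölder seminorm `[u]_{C^α(𝕋^d)}` for functions with values in a normed space. -/
def holderSemi {E : Type*} [SeminormedAddCommGroup E] (α : ℝ) (u : Pt d → E) : ℝ :=
  sSup {r | ∃ x y : Pt d, x ≠ y ∧ r = ‖u x - u y‖ / edist' x y ^ α}

/-- The Hölder norm `‖u‖_{C^{k+α}(𝕋^d)}`. -/
def cNorm (k : ℕ) (α : ℝ) (u : Pt d → ℝ) : ℝ :=
  (∑ j ∈ Finset.range (k+1), sSup {r | ∃ x : Pt d, r = ‖iteratedFDeriv ℝ j u x‖}) +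
    holderSemi α (iteratedFDeriv ℝ k u)

/-- The Hölder norm `‖u‖_{C^θ(𝕋^d)}` of real (non-integer) order `θ > 0`. -/
def cNormR (θ : ℝ) (u : Pt d → ℝ) : ℝ := cNorm ⌊θ⌋₊ (θ - ⌊θ⌋₊) u

/-- Membership in the Hölder space `C^{k+α}(𝕋^d)`. -/
def MemHolderSpace (k : ℕ) (α : ℝ) (u : Pt d → ℝ) : Prop :=
  ContDiff ℝ k u ∧ ∃ M : ℝ, ∀ x y : Pt d,
    ‖iteratedFDeriv ℝ k u x - iteratedFDeriv ℝ k u y‖ ≤ M * edist' x y ^ α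

/-- Membership in the Hölder space `C^θ(𝕋^d)` of real order. -/
def MemHolderSpaceR (θ : ℝ) (u : Pt d → ℝ) : Prop :=
  MemHolderSpace ⌊θ⌋₊ (θ - ⌊θ⌋₊) u

/-- The gradient of a function on `ℝ^d`. -/
def grad (u : Pt d → ℝ) (x : Pt d) : Pt d := fun i => fderiv ℝ u x (Pi.single i 1)

/-- The Laplacian of a function on `ℝ^d`. -/
def lap (u : Pt d → ℝ) (x : Pt d) : ℝ :=
  ∑ i, iteratedFDeriv ℝ 2 u x (fun _ => Pi.single i 1)

/-- The divergence of a vector field on `ℝ^d`. -/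
def divg (V : Pt d → Pt d) (x : Pt d) : ℝ :=
  ∑ i, fderiv ℝ (fun y => V y i) x (Pi.single i 1)

/-- Time derivative of a space-time function `u = u(x,t)`. -/
def tDeriv (u : Pt d → ℝ → ℝ) (x : Pt d) (t : ℝ) : ℝ := deriv (u x) t

/-- The norm of the parabolic Bessel potential space
`𝓗_p^{μ;s}(Q_T) = {u ∈ L^p(0,T;H^μ_p), ∂_t u ∈ L^p(0,T;H^{μ-2s}_p)}`. -/
def parBesselNorm (s μ p T : ℝ) (u : Pt d → ℝ → ℝ) : ℝ :=
  (∫ t in Set.Ioc (0:ℝ) T, besselNorm μ p (fun x => u x t) ^ p) ^ (1/p) +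
  (∫ t in Set.Ioc (0:ℝ) T, besselNorm (μ - 2*s) p (fun x => tDeriv u x t) ^ p) ^ (1/p)

/-- Membership in the parabolic Bessel potential space `𝓗_p^{μ;s}(Q_T)`. -/
def MemParBessel (s μ p T : ℝ) (u : Pt d → ℝ → ℝ) : Prop :=
  (∀ t, IsPeriodicF fun x => u x t) ∧
  IntegrableOn (fun t => besselNorm μ p (fun x => u x t) ^ p) (Set.Ioc 0 T) ∧
  IntegrableOn (fun t => besselNorm (μ - 2*s) p (fun x => tDeriv u x t) ^ p) (Set.Ioc 0 T)

/-- The norm of the parabolic Hölder space `𝒞^{α,β}(Q_T)`: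
`‖u‖_∞ + sup_t [u(·,t)]_{C^α} + sup_x [u(x,·)]_{C^β}`. -/
def parHolderNorm (T α β : ℝ) (u : Pt d → ℝ → ℝ) : ℝ :=
  sSup {r | ∃ (x : Pt d) (t : ℝ), t ∈ Icc (0:ℝ) T ∧ r = |u x t|} +
  sSup {r | ∃ (x y : Pt d) (t : ℝ), t ∈ Icc (0:ℝ) T ∧ x ≠ y ∧
    r = |u x t - u y t| / edist' x y ^ α} +
  sSup {r | ∃ (x : Pt d) (t τ : ℝ), t ∈ Icc (0:ℝ) T ∧ τ ∈ Icc (0:ℝ) T ∧ t ≠ τ ∧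
    r = |u x t - u x τ| / |t - τ| ^ β}

/-- Membership in the parabolic Hölder space `𝒞^{α,β}(Q_T)`. -/
def MemParHolder (T α β : ℝ) (u : Pt d → ℝ → ℝ) : Prop :=
  ContinuousOn (fun z : Pt d × ℝ => u z.1 z.2) (Set.univ ×ˢ Set.Icc 0 T) ∧
  ∃ M : ℝ, (∀ x y t, t ∈ Icc (0:ℝ) T → |u x t - u y t| ≤ M * edist' x y ^ α) ∧
    (∀ x t τ, t ∈ Icc (0:ℝ) T → τ ∈ Icc (0:ℝ) T → |u x t - u x τ| ≤ M * |t - τ| ^ β)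

/-- Norm of the `C^{β}([0,T];H^μ_p(𝕋^d))`-type spaces. -/
def besselHolderNorm (β μ p T : ℝ) (u : Pt d → ℝ → ℝ) : ℝ :=
  sSup {r | ∃ t ∈ Icc (0:ℝ) T, r = besselNorm μ p fun x => u x t} +
  sSup {r | ∃ t ∈ Icc (0:ℝ) T, ∃ τ ∈ Icc (0:ℝ) T, t ≠ τ ∧
    r = besselNorm μ p (fun x => u x t - u x τ) / |t - τ| ^ β}

/-- The mixed derivative `∂_t^r D_x^j u` of a space-time function. -/
def mixD (j r : ℕ) (u : Pt d → ℝ → ℝ) (x : Pt d) (t : ℝ) :=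
  iteratedFDeriv ℝ j (fun y => iteratedDeriv r (u y) t) x

/-- The norm of the classical parabolic Hölder space `C^{2k+α,k+α/2}(Q_T)`. -/
def parCNorm (T : ℝ) (k : ℕ) (α : ℝ) (u : Pt d → ℝ → ℝ) : ℝ :=
  (∑ r ∈ Finset.range (k+1), ∑ j ∈ Finset.range (2*k+1),
    if 2*r + j ≤ 2*k then
      sSup {c | ∃ (x : Pt d) (t : ℝ), t ∈ Icc (0:ℝ) T ∧ c = ‖mixD j r u x t‖}
    else 0) +
  (∑ r ∈ Finset.range (k+1), ∑ j ∈ Finset.range (2*k+1),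
    if 2*r + j = 2*k then
      (sSup {c | ∃ (x y : Pt d) (t : ℝ), t ∈ Icc (0:ℝ) T ∧ x ≠ y ∧
          c = ‖mixD j r u x t - mixD j r u y t‖ / edist' x y ^ α} +
       sSup {c | ∃ (x : Pt d) (t τ : ℝ), t ∈ Icc (0:ℝ) T ∧ τ ∈ Icc (0:ℝ) T ∧ t ≠ τ ∧
          c = ‖mixD j r u x t - mixD j r u x τ‖ / |t - τ| ^ (α/2)})
    else 0)

/-- Membership in the classical parabolic Hölder space `C^{2k+α,k+α/2}(Q_T)`. -/
def MemParC (T : ℝ) (k : ℕ) (α : ℝ) (u : Pt d → ℝ → ℝ) : Prop :=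
  (∀ t, ContDiff ℝ (2*k) fun y => u y t) ∧
  (∀ x, ContDiff ℝ k fun t => u x t) ∧
  (∀ (t : ℝ) (r : ℕ), r ≤ k → ContDiff ℝ (2*k - 2*r) fun y => iteratedDeriv r (u y) t) ∧
  (∀ r j, 2*r + j ≤ 2*k → Continuous fun z : Pt d × ℝ => mixD j r u z.1 z.2) ∧
  ∃ M : ℝ, ∀ r j, 2*r + j = 2*k →
      (∀ x y t, t ∈ Icc (0:ℝ) T → ‖mixD j r u x t - mixD j r u y t‖ ≤ M * edist' x y ^ α) ∧
      (∀ x t τ, t ∈ Icc (0:ℝ) T → τ ∈ Icc (0:ℝ) T →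
        ‖mixD j r u x t - mixD j r u x τ‖ ≤ M * |t - τ| ^ (α/2))

/-! ### Hypotheses on the Hamiltonian, the coupling and the data -/

/-- Hypotheses (H1), (H3)-(H5) on the Hamiltonian (without convexity and (H2)). -/
structure HamHypCore (d : ℕ) (H : Pt d → Pt d → ℝ) (γ cH CH CtH : ℝ) : Prop where
  smooth : ContDiff ℝ 3 fun q : Pt d × Pt d => H q.1 q.2
  periodic : ∀ p : Pt d, IsPeriodicF fun x => H x p
  nonneg : ∀ x p, 0 ≤ H x p
  zero : ∀ x, H x 0 = 0
  gamma_gt_one : 1 < γ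
  cH_pos : 0 < cH
  CH_pos : 0 < CH
  CtH_pos : 0 < CtH
  h1 : ∀ x p, CH * vnorm p ^ γ - cH ≤ dotP (grad (H x) p) p - H x p
  h3 : ∀ x p, ‖iteratedFDeriv ℝ 2 (fun y => H y p) x‖ ≤ CH * vnorm p ^ γ + CtH
  h4 : ∀ x p, ‖fderiv ℝ (fun y => fderiv ℝ (H y) p) x‖ ≤ CH * vnorm p ^ (γ-1) + CtH
  h5 : ∀ x p ξ, CH * vnorm p ^ (γ-2) * vnorm ξ ^ 2 - CtH ≤
        iteratedFDeriv ℝ 2 (H x) p (fun _ => ξ)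

/-- Full hypotheses (H1)-(H5) on the Hamiltonian, together with convexity in `p`. -/
structure HamHyp (d : ℕ) (H : Pt d → Pt d → ℝ) (γ cH CH CtH : ℝ)
    extends HamHypCore d H γ cH CH CtH : Prop where
  convex : ∀ x, ConvexOn ℝ Set.univ (H x)
  h2 : ∀ x p q, H x p - H x q ≤ CH * (vnorm p ^ (γ-1) + vnorm q ^ (γ-1)) * vnorm (p - q)

/-- `μ` is a Borel probability measure on the torus (realized as a measure on `ℝ^d`
supported on the fundamental domain). -/
def ProbOnTorus (d : ℕ) (μ : Measure (Pt d)) : Prop :=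
  IsProbabilityMeasure μ ∧ μ (torusBox d)ᶜ = 0

/-- The Monge–Kantorovich distance `𝐝_1`. -/
def d1 (μ ν : Measure (Pt d)) : ℝ :=
  sSup {r | ∃ φ : Pt d → ℝ, IsPeriodicF φ ∧ LipschitzWith 1 φ ∧
    r = (∫ x, φ x ∂μ) - ∫ x, φ x ∂ν}

/-- The probability measure with density `m` on the torus. -/
def densMeasure (m : Pt d → ℝ) : Measure (Pt d) :=
  (volume.restrict (torusBox d)).withDensity fun x => ENNReal.ofReal (m x)

/-- Hypotheses (F1)-(F3) on the regularizing coupling `F`. -/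
structure CouplingHyp (d : ℕ) (F : Measure (Pt d) → Pt d → ℝ) (α CF : ℝ) : Prop where
  alpha_mem : α ∈ Set.Ioo (0:ℝ) 1
  CF_pos : 0 < CF
  periodic : ∀ μ, ProbOnTorus d μ → IsPeriodicF (F μ)
  regular : ∀ μ, ProbOnTorus d μ → MemHolderSpace 2 α (F μ)
  continuous : ∀ μ, ProbOnTorus d μ → ∀ ε > 0, ∃ δ > 0, ∀ ν, ProbOnTorus d ν →
    d1 μ ν < δ → cNorm 2 α (fun x => F μ x - F ν x) < ε
  lipschitz : ∀ μ ν, ProbOnTorus d μ → ProbOnTorus d ν →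
    cNorm 2 α (fun x => F μ x - F ν x) ≤ CF * d1 μ ν
  bounded : ∀ μ, ProbOnTorus d μ → cNorm 2 α (F μ) ≤ CF

/-- Hypotheses (I) on the data `u_T, m_0`. -/
structure DataHyp (d : ℕ) (α : ℝ) (uT m0 : Pt d → ℝ) : Prop where
  uT_per : IsPeriodicF uT
  m0_per : IsPeriodicF m0
  uT_reg : MemHolderSpace 4 α uT
  m0_reg : MemHolderSpace 4 α m0
  m0_nonneg : ∀ x, 0 ≤ m0 x
  m0_mass : (∫ x in torusBox d, m0 x) = 1

/-! ### Solution concepts -/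

/-- Classical solution of the (possibly viscous, `σ ≥ 0`) fractional MFG system. -/
structure IsClassicalSolMFG (d : ℕ) (s σ T : ℝ) (H : Pt d → Pt d → ℝ)
    (F : Measure (Pt d) → Pt d → ℝ) (uT m0 : Pt d → ℝ)
    (u m : Pt d → ℝ → ℝ) : Prop where
  u_per : ∀ t, IsPeriodicF fun x => u x t
  m_per : ∀ t, IsPeriodicF fun x => m x t
  u_cont : ContinuousOn (fun z : Pt d × ℝ => u z.1 z.2) (Set.univ ×ˢ Set.Icc 0 T)
  m_cont : ContinuousOn (fun z : Pt d × ℝ => m z.1 z.2) (Set.univ ×ˢ Set.Icc 0 T)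
  u_smooth_x : ∀ t, ContDiff ℝ 2 fun x => u x t
  m_smooth_x : ∀ t, ContDiff ℝ 2 fun x => m x t
  u_diff_t : ∀ x, ∀ t ∈ Set.Ioo (0:ℝ) T, DifferentiableAt ℝ (u x) t
  m_diff_t : ∀ x, ∀ t ∈ Set.Ioo (0:ℝ) T, DifferentiableAt ℝ (m x) t
  ut_cont : ContinuousOn (fun z : Pt d × ℝ => tDeriv u z.1 z.2) (Set.univ ×ˢ Set.Ioo 0 T)
  mt_cont : ContinuousOn (fun z : Pt d × ℝ => tDeriv m z.1 z.2) (Set.univ ×ˢ Set.Ioo 0 T)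
  uxx_cont : ContinuousOn (fun z : Pt d × ℝ => iteratedFDeriv ℝ 2 (fun y => u y z.2) z.1)
    (Set.univ ×ˢ Set.Ioo 0 T)
  mxx_cont : ContinuousOn (fun z : Pt d × ℝ => iteratedFDeriv ℝ 2 (fun y => m y z.2) z.1)
    (Set.univ ×ˢ Set.Ioo 0 T)
  hjb : ∀ x : Pt d, ∀ t ∈ Set.Ioo (0:ℝ) T,
    -tDeriv u x t - σ * lap (fun y => u y t) x + fracLap s (fun y => u y t) x
      + H x (grad (fun y => u y t) x)
      = F (densMeasure fun y => m y t) x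
  fp : ∀ x : Pt d, ∀ t ∈ Set.Ioo (0:ℝ) T,
    tDeriv m x t - σ * lap (fun y => m y t) x + fracLap s (fun y => m y t) x
      - divg (fun y i => m y t * grad (H y) (grad (fun z => u z t) y) i) x = 0
  m_init : ∀ x, m x 0 = m0 x
  u_final : ∀ x, u x T = uT x

/-- Test functions `φ ∈ C^∞(𝕋^d × [0,T))` (vanishing near `t = T`). -/
def TestFn0 (d : ℕ) (T : ℝ) (φ : Pt d → ℝ → ℝ) : Prop :=
  ContDiff ℝ (⊤ : ℕ∞) (fun z : Pt d × ℝ => φ z.1 z.2) ∧ (∀ t, IsPeriodicF fun x => φ x t) ∧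
  ∃ T' : ℝ, T' < T ∧ ∀ (x : Pt d) (t : ℝ), T' ≤ t → φ x t = 0

/-- Test functions `φ ∈ C^∞(𝕋^d × (0,T])` (vanishing near `t = 0`). -/
def TestFnT (d : ℕ) (φ : Pt d → ℝ → ℝ) : Prop :=
  ContDiff ℝ (⊤ : ℕ∞) (fun z : Pt d × ℝ => φ z.1 z.2) ∧ (∀ t, IsPeriodicF fun x => φ x t) ∧
  ∃ ε : ℝ, 0 < ε ∧ ∀ (x : Pt d) (t : ℝ), t ≤ ε → φ x t = 0

/-- Weak (energy) solution of the fractional Fokker-Planck equation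
`∂_t m + (-Δ)^s m + div(b m) = 0`, `m(0) = m_0`. -/
def WeakSolFP (d : ℕ) (s T : ℝ) (b : Pt d → ℝ → Pt d) (m0 : Pt d → ℝ)
    (m : Pt d → ℝ → ℝ) : Prop :=
  (∀ t, IsPeriodicF fun x => m x t) ∧
  IntegrableOn (fun t => besselNorm s 2 (fun x => m x t) ^ 2) (Set.Ioc 0 T) ∧
  IntegrableOn (fun t => besselNorm (-1) 2 (fun x => tDeriv m x t) ^ 2) (Set.Ioc 0 T) ∧
  ∀ φ : Pt d → ℝ → ℝ, TestFn0 d T φ →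
    (∫ t in Set.Ioc (0:ℝ) T, ∫ x in torusBox d,
      (-(m x t * tDeriv φ x t) - m x t * dotP (b x t) (grad (fun y => φ y t) x)
        + fracLap (s/2) (fun y => m y t) x * fracLap (s/2) (fun y => φ y t) x))
    = ∫ x in torusBox d, φ x 0 * m0 x

/-- Weak (energy) solution of the fractional HJB equation
`-∂_t u + (-Δ)^s u + H(x,Du) = V`, `u(T) = u_T`. -/
def WeakSolHJB (d : ℕ) (s T : ℝ) (H : Pt d → Pt d → ℝ) (V : Pt d → ℝ → ℝ)
    (uT : Pt d → ℝ) (u : Pt d → ℝ → ℝ) : Prop :=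
  (∀ t, IsPeriodicF fun x => u x t) ∧
  IntegrableOn (fun t => besselNorm s 2 (fun x => u x t) ^ 2) (Set.Ioc 0 T) ∧
  IntegrableOn (fun t => besselNorm (-s) 2 (fun x => tDeriv u x t) ^ 2) (Set.Ioc 0 T) ∧
  (∃ M : NNReal, ∀ t ∈ Set.Icc (0:ℝ) T, LipschitzWith M fun x => u x t) ∧
  ∀ φ : Pt d → ℝ → ℝ, TestFnT d φ →
    (-(∫ x in torusBox d, φ x T * uT x)) +
    (∫ t in Set.Ioc (0:ℝ) T, ∫ x in torusBox d,
      (tDeriv φ x t * u x t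
        + fracLap (s/2) (fun y => u y t) x * fracLap (s/2) (fun y => φ y t) x
        + H x (grad (fun y => u y t) x) * φ x t))
    = ∫ t in Set.Ioc (0:ℝ) T, ∫ x in torusBox d, V x t * φ x t

/-- Weak (energy) solution of the fractional MFG system. -/
def WeakSolMFG (d : ℕ) (s T : ℝ) (H : Pt d → Pt d → ℝ)
    (F : Measure (Pt d) → Pt d → ℝ) (uT m0 : Pt d → ℝ)
    (u m : Pt d → ℝ → ℝ) : Prop :=
  WeakSolHJB d s T H (fun x t => F (densMeasure fun y => m y t) x) uT u ∧
  WeakSolFP d s T (fun x t => -grad (H x) (grad (fun y => u y t) x)) m0 m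

end FracMFG

open FracMFG


namespace FracMFG
variable {d : ℕ}

open scoped Pointwise in
lemma lint_translate (g : Pt d → ENNReal) (hg : IsPeriodicF g) (h : Pt d) :
    ∫⁻ x in torusBox d, g (x + h) = ∫⁻ x in torusBox d, g x := by
  have hfd : IsAddFundamentalDomain (Submodule.span ℤ (Set.range (Pi.basisFun ℝ (Fin d))))
      (torusBox d) volume := by
    have := ZSpan.isAddFundamentalDomain (Pi.basisFun ℝ (Fin d)) volume
    rwa [ZSpan.fundamentalDomain_pi_basisFun] at this
  have hfd2 := hfd.vadd_of_comm h
  have hper : ∀ (v : Submodule.span ℤ (Set.range (Pi.basisFun ℝ (Fin d)))) (x : Pt d),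
      g (v +ᵥ x) = g x := by
    rintro ⟨v, hv⟩ x
    rw [Module.Basis.mem_span_iff_repr_mem] at hv
    choose k hk using hv
    have : v = fun i => (k i : ℝ) := by
      ext i; simpa using (hk i).symm
    rw [← hg k x]
    congr 1
    subst this
    ext i
    simp [Submodule.vadd_def, add_comm]
  have : VAddInvariantMeasure (Submodule.span ℤ (Set.range (Pi.basisFun ℝ (Fin d)))) (Pt d)
      volume := ⟨fun c s _ => measure_preimage_add volume (c : Pt d) s⟩
  have key := hfd2.setLIntegral_eq hfd g hper
  rw [← key]
  have hmp : MeasurePreserving (fun x : Pt d => x + h) volume volume :=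
    measurePreserving_add_right volume h
  rw [← hmp.setLIntegral_comp_preimage_emb (measurableEmbedding_addRight h) g
    (h +ᵥ torusBox d)]
  congr 2
  ext x
  simp [Set.mem_vadd_set_iff_neg_vadd_mem]

end FracMFG


namespace FracMFG
variable {d : ℕ}

lemma jensen_lint {Z : Type*} [MeasurableSpace Z] (μ : Measure Z) {p : ℝ} (hp : 1 < p)
    (f : Z → ENNReal) (hf : AEMeasurable f μ) :
    (∫⁻ z, f z ∂μ) ^ p ≤ μ univ ^ (p - 1) * ∫⁻ z, f z ^ p ∂μ := by
  have hpq := Real.HolderConjugate.conjExponent hp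
  have hp0 : 0 < p := by linarith
  have h := ENNReal.lintegral_mul_le_Lp_mul_Lq μ hpq hf (aemeasurable_const (b := (1 : ENNReal)))
  simp only [Pi.mul_apply, mul_one, ENNReal.one_rpow, lintegral_const, one_mul] at h
  calc (∫⁻ z, f z ∂μ) ^ p ≤ _ := ENNReal.rpow_le_rpow h hp0.le
    _ = _ := by
      rw [ENNReal.mul_rpow_of_nonneg _ _ hp0.le, ← ENNReal.rpow_mul, ← ENNReal.rpow_mul, mul_comm]
      have h1 : 1 / p * p = 1 := by field_simp
      have h2 : 1 / p.conjExponent * p = p - 1 := by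
        rw [Real.conjExponent]; field_simp
      rw [h1, h2, ENNReal.rpow_one]

lemma minkowski_lint {X Z : Type*} [MeasurableSpace X] [MeasurableSpace Z] (μ : Measure X)
    (ν : Measure Z) [SFinite μ] [SFinite ν] {p : ℝ} (hp : 1 < p)
    (w : Z → ENNReal) (hw : Measurable w)
    (f : X → Z → ENNReal) (hf : Measurable (Function.uncurry f)) (B : ENNReal)
    (hB : ∀ z, ∫⁻ x, f x z ^ p ∂μ ≤ B) :
    ∫⁻ x, (∫⁻ z, w z * f x z ∂ν) ^ p ∂μ ≤ (∫⁻ z, w z ∂ν) ^ p * B := by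
  set W := ∫⁻ z, w z ∂ν with hW
  have hfx : ∀ x, Measurable (f x) := fun x => hf.comp (measurable_prodMk_left)
  calc ∫⁻ x, (∫⁻ z, w z * f x z ∂ν) ^ p ∂μ
      ≤ ∫⁻ x, W ^ (p - 1) * ∫⁻ z, w z * f x z ^ p ∂ν ∂μ := by
        refine lintegral_mono fun x => ?_
        have := jensen_lint (ν.withDensity w) hp (f x) (hfx x).aemeasurable
        rw [lintegral_withDensity_eq_lintegral_mul _ hw (hfx x),
          lintegral_withDensity_eq_lintegral_mul _ hw ((hfx x).pow_const p)] at this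
        simpa [withDensity_apply _ MeasurableSet.univ] using this
    _ = W ^ (p - 1) * ∫⁻ x, ∫⁻ z, w z * f x z ^ p ∂ν ∂μ := by
        apply lintegral_const_mul
        apply Measurable.lintegral_prod_right'
          (f := fun q : X × Z => w q.2 * f q.1 q.2 ^ p)
        exact (hw.comp measurable_snd).mul (hf.pow_const p)
    _ = W ^ (p - 1) * ∫⁻ z, ∫⁻ x, w z * f x z ^ p ∂μ ∂ν := by
        rw [lintegral_lintegral_swap]
        exact ((hw.comp measurable_snd).mul (hf.pow_const p)).aemeasurable
    _ ≤ W ^ (p - 1) * ∫⁻ z, w z * B ∂ν := by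
        gcongr with z
        rw [lintegral_const_mul]
        · gcongr; exact hB z
        · exact (hf.comp (measurable_prodMk_right)).pow_const p
    _ = W ^ p * B := by
        rw [lintegral_mul_const _ hw, ← mul_assoc]
        congr 1
        calc W ^ (p - 1) * W = W ^ (p - 1) * W ^ (1 : ℝ) := by rw [ENNReal.rpow_one]
          _ = W ^ (p - 1 + 1) :=
            (ENNReal.rpow_add_of_nonneg _ _ (by linarith) (by norm_num)).symm
          _ = W ^ p := by congr 1; ring

lemma ftc_enorm (φ φ' : ℝ → ℝ) (h : ∀ t, HasDerivAt φ (φ' t) t) {a b : ℝ} (hab : a ≤ b) :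
    ‖φ b - φ a‖ₑ ≤ ∫⁻ t in Ioc a b, ‖φ' t‖ₑ := by
  by_cases hfin : ∫⁻ t in Ioc a b, ‖φ' t‖ₑ = ⊤
  · rw [hfin]; exact le_top
  have hd : φ' = deriv φ := funext fun t => (h t).deriv.symm
  have hm : Measurable φ' := hd ▸ measurable_deriv φ
  have hintg : IntervalIntegrable φ' volume a b := by
    rw [intervalIntegrable_iff_integrableOn_Ioc_of_le hab]
    exact ⟨hm.aestronglyMeasurable, lt_top_iff_ne_top.2 hfin⟩
  rw [← intervalIntegral.integral_eq_sub_of_hasDerivAt (fun t _ => h t) hintg,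
    intervalIntegral.integral_of_le hab]
  exact enorm_integral_le_lintegral_enorm _

lemma second_diff_one (φ φ' : ℝ → ℝ) (h : ∀ t, HasDerivAt φ (φ' t) t) :
    ‖φ 1 + φ (-1) - 2 * φ 0‖ₑ ≤ ∫⁻ t in Ioc (-1 : ℝ) 1, ‖φ' t‖ₑ := by
  have h1 := ftc_enorm φ φ' h (a := 0) (b := 1) (by norm_num)
  have h2 := ftc_enorm φ φ' h (a := -1) (b := 0) (by norm_num)
  have e : Ioc (-1 : ℝ) 1 = Ioc (-1) 0 ∪ Ioc 0 1 := by
    rw [Ioc_union_Ioc_eq_Ioc] <;> norm_num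
  rw [e, lintegral_union measurableSet_Ioc]
  · calc _ = ‖(φ 1 - φ 0) - (φ 0 - φ (-1))‖ₑ := by congr 1; ring
      _ ≤ ‖φ 1 - φ 0‖ₑ + ‖φ 0 - φ (-1)‖ₑ := enorm_sub_le
      _ ≤ _ := by rw [add_comm]; gcongr
  · exact Set.disjoint_left.2 fun x hx hy => by simp at hx hy; linarith

lemma second_diff_two (φ φ' φ'' : ℝ → ℝ) (h : ∀ t, HasDerivAt φ (φ' t) t)
    (h' : ∀ t, HasDerivAt φ' (φ'' t) t) :
    ‖φ 1 + φ (-1) - 2 * φ 0‖ₑ ≤ ∫⁻ t in Ioc (-1 : ℝ) 1, ‖φ'' t‖ₑ := by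
  have h1 := ftc_enorm (fun t => φ t + φ (-t)) (fun t => φ' t - φ' (-t)) (fun t => by
    have := (h (-t)).comp t (hasDerivAt_neg t)
    have := (h t).add this
    convert! this using 1
    ring) (a := 0) (b := 1) (by norm_num)
  calc _ = ‖(φ 1 + φ (-1)) - (φ 0 + φ (-0))‖ₑ := by congr 1; simp; ring
    _ ≤ _ := h1
    _ ≤ ∫⁻ t in Ioc (0 : ℝ) 1, ∫⁻ t in Ioc (-1 : ℝ) 1, ‖φ'' t‖ₑ := by
      refine setLIntegral_mono' measurableSet_Ioc fun t ht => ?_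
      refine (ftc_enorm φ' φ'' h' (a := -t) (b := t) (by linarith [ht.1])).trans ?_
      exact lintegral_mono_set (Ioc_subset_Ioc (by linarith [ht.2]) ht.2)
    _ = _ := by simp

lemma hasDerivAt_line (x h : Pt d) (t : ℝ) : HasDerivAt (fun t : ℝ => x + t • h) h t := by
  simpa using ((hasDerivAt_id t).smul_const h).const_add x

lemma diff_bound_one (u : Pt d → ℝ) (hu : Differentiable ℝ u) (x h : Pt d) :
    ‖u (x + h) + u (x - h) - 2 * u x‖ₑ ≤
      ‖h‖ₑ ^ 1 * ∫⁻ t in Ioc (-1 : ℝ) 1, ‖fderiv ℝ u (x + t • h)‖ₑ := by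
  have := second_diff_one (fun t : ℝ => u (x + t • h)) (fun t => fderiv ℝ u (x + t • h) h)
    (fun t => (hu _).hasFDerivAt.comp_hasDerivAt t (hasDerivAt_line x h t))
  simp only [one_smul, neg_smul, zero_smul, add_zero, ← sub_eq_add_neg] at this
  refine this.trans ?_
  rw [← lintegral_const_mul' _ _ (by simp)]
  refine lintegral_mono fun t => ?_
  rw [mul_comm, pow_one]
  exact ContinuousLinearMap.le_opENorm _ _

lemma enorm_iter_two (u : Pt d → ℝ) (x : Pt d) :
    ‖iteratedFDeriv ℝ 2 u x‖ = ‖fderiv ℝ (fderiv ℝ u) x‖ := by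
  rw [← norm_iteratedFDeriv_fderiv, ← norm_iteratedFDeriv_fderiv, norm_iteratedFDeriv_zero]

lemma diff_bound_two (u : Pt d → ℝ) (hu : Differentiable ℝ u)
    (hu' : Differentiable ℝ (fderiv ℝ u)) (x h : Pt d) :
    ‖u (x + h) + u (x - h) - 2 * u x‖ₑ ≤
      ‖h‖ₑ ^ 2 * ∫⁻ t in Ioc (-1 : ℝ) 1, ‖fderiv ℝ (fderiv ℝ u) (x + t • h)‖ₑ := by
  have := second_diff_two (fun t : ℝ => u (x + t • h)) (fun t => fderiv ℝ u (x + t • h) h)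
    (fun t => fderiv ℝ (fderiv ℝ u) (x + t • h) h h)
    (fun t => (hu _).hasFDerivAt.comp_hasDerivAt t (hasDerivAt_line x h t))
    (fun t => by
      have := (hu' _).hasFDerivAt.comp_hasDerivAt t (hasDerivAt_line x h t)
      simpa using this.clm_apply (hasDerivAt_const t h))
  simp only [one_smul, neg_smul, zero_smul, add_zero, ← sub_eq_add_neg] at this
  refine this.trans ?_
  rw [← lintegral_const_mul' _ _ (by simp)]
  refine lintegral_mono fun t => ?_
  calc _ ≤ ‖fderiv ℝ (fderiv ℝ u) (x + t • h) h‖ₑ * ‖h‖ₑ := ContinuousLinearMap.le_opENorm _ _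
    _ ≤ (‖fderiv ℝ (fderiv ℝ u) (x + t • h)‖ₑ * ‖h‖ₑ) * ‖h‖ₑ := by
      gcongr; exact ContinuousLinearMap.le_opENorm _ _
    _ = _ := by ring

end FracMFG


namespace FracMFG
variable {d : ℕ}

lemma fChar_eq_mFourier (k : Fin d → ℤ) (x : Pt d) :
    fChar k x = UnitAddTorus.mFourier k (fun i => (x i : UnitAddCircle)) := by
  simp only [fChar, UnitAddTorus.mFourier, ContinuousMap.coe_mk, fourier_coe_apply]
  rw [← Complex.exp_sum]
  congr 1
  push_cast
  rw [Finset.mul_sum]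
  refine Finset.sum_congr rfl fun i _ => ?_
  simp; ring

lemma fChar_add (k : Fin d → ℤ) (x h : Pt d) : fChar k (x + h) = fChar k x * fChar k h := by
  simp only [fChar, ← Complex.exp_add]
  congr 1
  rw [← mul_add, ← Complex.ofReal_add, ← Finset.sum_add_distrib]
  simp [mul_add]

lemma norm_fChar (k : Fin d → ℤ) (x : Pt d) : ‖fChar k x‖ = 1 := by
  rw [fChar, show (2 * (π : ℂ) * Complex.I * ((∑ i, (k i : ℝ) * x i : ℝ) : ℂ)) =
    ((2 * π * ∑ i, (k i : ℝ) * x i : ℝ) : ℂ) * Complex.I by push_cast; ring]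
  exact Complex.norm_exp_ofReal_mul_I _

lemma box_ae_eq : ({x : Pt d | ∀ i, x i ∈ Ioc ((0 : Pt d) i) ((0 : Pt d) i + 1)} : Set (Pt d))
    =ᵐ[volume] torusBox d := by
  have h1 := Measure.univ_pi_Ico_ae_eq_Icc (μ := fun _ : Fin d => (volume : Measure ℝ))
    (f := fun _ => (0 : ℝ)) (g := fun _ => (1 : ℝ))
  have h2 := Measure.univ_pi_Ioc_ae_eq_Icc (μ := fun _ : Fin d => (volume : Measure ℝ))
    (f := fun _ => (0 : ℝ)) (g := fun _ => (1 : ℝ))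
  have h3 := h2.trans h1.symm
  have e : ({x : Pt d | ∀ i, x i ∈ Ioc ((0 : Pt d) i) ((0 : Pt d) i + 1)} : Set (Pt d)) =
    Set.univ.pi fun _ : Fin d => Set.Ioc (0:ℝ) 1 := by ext x; simp
  rw [e]
  exact h3

lemma fourier_inversion (u : Pt d → ℝ) (hu : Continuous u) (hper : IsPeriodicF u)
    (hs : Summable (fun k => fCoeff u k)) (x : Pt d) :
    HasSum (fun k => fCoeff u k * fChar k x) (u x : ℂ) := by
  have hq : IsOpenQuotientMap (Pi.map (fun _ : Fin d => ((↑) : ℝ → UnitAddCircle))) :=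
    IsOpenQuotientMap.piMap fun _ => QuotientAddGroup.isOpenQuotientMap_mk
  let q : C(Pt d, UnitAddTorus (Fin d)) := ⟨_, hq.continuous⟩
  let f : C(Pt d, ℂ) := ⟨fun x => (u x : ℂ), by fun_prop⟩
  have hqq : Topology.IsQuotientMap q := hq.isQuotientMap
  have hfac : Function.FactorsThrough f q := by
    intro a b hab
    have : ∀ i, ∃ n : ℤ, b i = a i + n := by
      intro i
      have hi : (a i : UnitAddCircle) = b i := congrFun hab i
      rw [eq_comm, ← sub_eq_zero, ← AddCircle.coe_sub, AddCircle.coe_eq_zero_iff] at hi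
      obtain ⟨n, hn⟩ := hi
      refine ⟨n, ?_⟩
      simp at hn
      linarith
    choose k hk using this
    have hb : b = fun i => a i + (k i : ℝ) := funext hk
    simp only [f, ContinuousMap.coe_mk]
    rw [hb, hper]
  let F : C(UnitAddTorus (Fin d), ℂ) := hqq.lift f hfac
  have hF : ∀ x : Pt d, F (fun i => (x i : UnitAddCircle)) = (u x : ℂ) := by
    intro x
    have := hqq.lift_comp f hfac
    exact DFunLike.congr_fun this x
  have hc : ∀ k, UnitAddTorus.mFourierCoeff F k = fCoeff u k := by
    intro k
    rw [UnitAddTorus.mFourierCoeff_eq_integral F k 0, setIntegral_congr_set box_ae_eq, fCoeff]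
    refine integral_congr_ae (ae_of_all _ fun x => ?_)
    simp only [hF, fChar_eq_mFourier, smul_eq_mul]
    ring
  have := UnitAddTorus.hasSum_mFourier_series_apply_of_summable (f := F)
    (by rw [show UnitAddTorus.mFourierCoeff F = _ from funext hc]; exact hs) (fun i => (x i : UnitAddCircle))
  simpa only [hc, hF, ← fChar_eq_mFourier, smul_eq_mul] using this

end FracMFG


namespace FracMFG
variable {d : ℕ}

/-- The standard Gaussian measure. -/
def gam (d : ℕ) : Measure (Pt d) := Measure.pi fun _ => ProbabilityTheory.gaussianReal 0 1

/-- The radial part of the Levy measure. -/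
def tau (s : ℝ) : Measure ℝ :=
  (volume.restrict (Ioi 0)).withDensity fun t => ENNReal.ofReal (t ^ (-1 - 2 * s))

instance : IsProbabilityMeasure (gam d) := by unfold gam; infer_instance

instance (s : ℝ) : SFinite (tau s) := by unfold tau; infer_instance

lemma gam_cos (a : Pt d) : ∫ y, Real.cos (∑ i, a i * y i) ∂(gam d) =
    Real.exp (-(∑ i, a i ^ 2) / 2) := by
  have h : ∫ y, Complex.exp ((∑ i, a i * y i : ℝ) * Complex.I) ∂(gam d) =
      ((Real.exp (-(∑ i, a i ^ 2) / 2) : ℝ) : ℂ) := by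
    have e : ∀ y : Pt d, Complex.exp ((∑ i, a i * y i : ℝ) * Complex.I) =
        ∏ i, Complex.exp ((a i : ℂ) * (y i : ℂ) * Complex.I) := by
      intro y
      rw [← Complex.exp_sum]; push_cast; rw [Finset.sum_mul]
    simp_rw [e]
    rw [gam, integral_fintype_prod_eq_prod (𝕜 := ℂ)
      (fun i (y : ℝ) => Complex.exp ((a i : ℂ) * (y : ℂ) * Complex.I))]
    have e2 : ∀ i, ∫ y : ℝ, Complex.exp ((a i : ℂ) * (y : ℂ) * Complex.I)
        ∂(ProbabilityTheory.gaussianReal 0 1) = Complex.exp (-(a i : ℂ) ^ 2 / 2) := by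
      intro i
      have := ProbabilityTheory.charFun_gaussianReal (μ := 0) (v := 1) (a i)
      rw [charFun_apply_real] at this
      rw [this]; congr 1; simp; ring
    simp_rw [e2]
    rw [← Complex.exp_sum]
    push_cast
    congr 1
    rw [← Finset.sum_neg_distrib, Finset.sum_div]
  have hintg : Integrable (fun y : Pt d => Complex.exp ((∑ i, a i * y i : ℝ) * Complex.I))
      (gam d) := by
    refine Integrable.of_bound (C := 1) (Continuous.aestronglyMeasurable (by fun_prop)) ?_
    exact ae_of_all _ fun y => (Complex.norm_exp_ofReal_mul_I _).le
  have h2 := Complex.reCLM.integral_comp_comm hintg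
  rw [h] at h2
  simp only [Complex.reCLM_apply, Complex.exp_ofReal_mul_I_re, Complex.ofReal_re] at h2
  exact h2

lemma gam_lint (a : Pt d) : ∫⁻ y, ENNReal.ofReal (1 - Real.cos (∑ i, a i * y i)) ∂(gam d) =
    ENNReal.ofReal (1 - Real.exp (-(∑ i, a i ^ 2) / 2)) := by
  have hc : Integrable (fun y : Pt d => Real.cos (∑ i, a i * y i)) (gam d) := by
    refine Integrable.of_bound (C := 1) (Continuous.aestronglyMeasurable (by fun_prop)) ?_
    exact ae_of_all _ fun y => by simpa using Real.abs_cos_le_one _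
  rw [← ofReal_integral_eq_lintegral_ofReal, integral_sub (integrable_const 1) hc, gam_cos]
  · simp
  · exact (integrable_const 1).sub hc
  · exact ae_of_all _ fun y => by simpa using Real.cos_le_one _

/-- The radial integrand. -/
def Kf (s l t : ℝ) : ℝ := t ^ (-1 - 2 * s) * (1 - Real.exp (-(2 * π * t * l) ^ 2 / 2))

lemma Kf_nonneg (s l : ℝ) {t : ℝ} (ht : 0 < t) : 0 ≤ Kf s l t := by
  refine mul_nonneg (Real.rpow_nonneg ht.le _) ?_
  rw [sub_nonneg, Real.exp_le_one_iff]
  have := sq_nonneg (2 * π * t * l)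
  linarith

lemma Kf_meas (s l : ℝ) : Measurable (Kf s l) := by unfold Kf; fun_prop

lemma intOn_rpow {b r : ℝ} (hb : -1 < b) (hr : 0 ≤ r) :
    IntegrableOn (fun t : ℝ => t ^ b) (Ioc 0 r) := by
  rw [← intervalIntegrable_iff_integrableOn_Ioc_of_le hr]
  exact intervalIntegral.intervalIntegrable_rpow' hb

lemma Kf_int {s : ℝ} (hs : 0 < s) (hs1 : s < 1) (l : ℝ) : IntegrableOn (Kf s l) (Ioi 0) := by
  rw [← Ioc_union_Ioi_eq_Ioi (zero_le_one (α := ℝ))]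
  refine IntegrableOn.union ?_ ?_
  · refine Integrable.mono' ((intOn_rpow (b := 1 - 2 * s) (r := 1) (by linarith)
      zero_le_one).const_mul ((2 * π * l) ^ 2 / 2)) (Kf_meas s l).aestronglyMeasurable ?_
    refine (ae_restrict_iff' measurableSet_Ioc).2 (ae_of_all _ fun t ht => ?_)
    rw [Real.norm_of_nonneg (Kf_nonneg s l ht.1), Kf]
    have e : t ^ (1 - 2 * s) = t ^ (-1 - 2 * s) * t ^ 2 := by
      rw [← Real.rpow_natCast t 2, ← Real.rpow_add ht.1]; congr 1; push_cast; ring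
    have h1 := Real.add_one_le_exp (-(2 * π * t * l) ^ 2 / 2)
    have h2 : 0 ≤ t ^ (-1 - 2 * s) := Real.rpow_nonneg ht.1.le _
    rw [e]
    calc _ ≤ t ^ (-1 - 2 * s) * ((2 * π * t * l) ^ 2 / 2) := by gcongr; linarith
      _ = _ := by ring
  · refine Integrable.mono' (integrableOn_Ioi_rpow_of_lt (a := -1 - 2 * s) (by linarith)
      zero_lt_one) (Kf_meas s l).aestronglyMeasurable ?_
    refine (ae_restrict_iff' measurableSet_Ioi).2 (ae_of_all _ fun t ht => ?_)
    have ht0 : 0 < t := lt_trans zero_lt_one ht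
    rw [Real.norm_of_nonneg (Kf_nonneg s l ht0), Kf]
    have h2 : 0 ≤ t ^ (-1 - 2 * s) := Real.rpow_nonneg ht0.le _
    have h3 := Real.exp_pos (-(2 * π * t * l) ^ 2 / 2)
    nlinarith

/-- The normalising constant. -/
def cs (s : ℝ) : ℝ := ∫ t in Ioi 0, Kf s 1 t

lemma cs_pos {s : ℝ} (hs : 0 < s) (hs1 : s < 1) : 0 < cs s := by
  rw [cs, setIntegral_pos_iff_support_of_nonneg_ae]
  · have : Function.support (Kf s 1) ∩ Ioi 0 = Ioi 0 := by
      refine Set.inter_eq_right.2 fun t ht => ?_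
      have ht : 0 < t := ht
      rw [Function.mem_support, Kf]
      have h1 : 0 < t ^ (-1 - 2 * s) := Real.rpow_pos_of_pos ht _
      have h2 : Real.exp (-(2 * π * t * 1) ^ 2 / 2) < 1 := by
        rw [Real.exp_lt_one_iff]
        have : 0 < (2 * π * t * 1) ^ 2 := by positivity
        linarith
      have : 0 < 1 - Real.exp (-(2 * π * t * 1) ^ 2 / 2) := by linarith
      positivity
    rw [this]; simp
  · refine (ae_restrict_iff' measurableSet_Ioi).2 (ae_of_all _ fun t ht => Kf_nonneg s 1 ht)
  · exact Kf_int hs hs1 1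

lemma Kf_scale {s : ℝ} (hs : 0 < s) {l : ℝ} (hl : 0 ≤ l) :
    ∫ t in Ioi 0, Kf s l t = l ^ (2 * s) * cs s := by
  rcases hl.eq_or_lt with rfl | hl
  · rw [Real.zero_rpow (by linarith)]; simp [Kf]
  · have := integral_comp_mul_left_Ioi' (Kf s 1) 0 hl
    rw [mul_zero] at this
    rw [cs, ← this, smul_eq_mul, ← integral_const_mul, ← integral_const_mul]
    refine setIntegral_congr_fun measurableSet_Ioi fun t ht => ?_
    have ht : 0 < t := ht
    simp only [Kf]
    rw [Real.mul_rpow hl.le ht.le]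
    have e : l ^ (2 * s) * (l * l ^ (-1 - 2 * s)) = 1 := by
      nth_rewrite 2 [← Real.rpow_one l]
      rw [← Real.rpow_add hl, ← Real.rpow_add hl]
      ring_nf; simp
    have e2 : (2 * π * (l * t) * 1) ^ 2 = (2 * π * t * l) ^ 2 := by ring
    rw [e2]
    linear_combination (-1) * t ^ (-1 - 2 * s) * (1 - Real.exp (-(2 * π * t * l) ^ 2 / 2)) * e

lemma tau_lint (s : ℝ) (f : ℝ → ENNReal) (hf : Measurable f) :
    ∫⁻ t, f t ∂(tau s) = ∫⁻ t in Ioi 0, ENNReal.ofReal (t ^ (-1 - 2 * s)) * f t := by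
  rw [tau, lintegral_withDensity_eq_lintegral_mul _ (by fun_prop) hf]
  rfl

lemma levy_lint {s : ℝ} (hs : 0 < s) (hs1 : s < 1) (k : Fin d → ℤ) :
    ∫⁻ z, ENNReal.ofReal (1 - Real.cos (2 * π * ∑ i, (k i : ℝ) * (z.1 • z.2) i))
      ∂((tau s).prod (gam d)) = ENNReal.ofReal (normZ k ^ (2 * s) * cs s) := by
  have hm : Measurable fun z : ℝ × Pt d =>
      ENNReal.ofReal (1 - Real.cos (2 * π * ∑ i, (k i : ℝ) * (z.1 • z.2) i)) := by
    simp only [Pi.smul_apply, smul_eq_mul]; fun_prop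
  rw [lintegral_prod _ hm.aemeasurable]
  have h1 : ∀ t : ℝ, ∫⁻ y, ENNReal.ofReal (1 - Real.cos (2 * π * ∑ i, (k i : ℝ) * (t • y) i))
      ∂(gam d) = ENNReal.ofReal (1 - Real.exp (-(2 * π * t * normZ k) ^ 2 / 2)) := by
    intro t
    have := gam_lint (d := d) (fun i => 2 * π * t * k i)
    have e : (2 * π * t * normZ k) ^ 2 = ∑ i, (2 * π * t * k i) ^ 2 := by
      rw [mul_pow, normZ, Real.sq_sqrt (Finset.sum_nonneg fun i _ => sq_nonneg _), Finset.mul_sum]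
      simp only [mul_pow]
    rw [e, ← this]
    congr 1; ext y; congr 3
    rw [Finset.mul_sum]
    refine Finset.sum_congr rfl fun i _ => ?_
    simp; ring
  simp_rw [h1]
  rw [tau_lint _ _ (by fun_prop), ← Kf_scale hs (show 0 ≤ normZ k from Real.sqrt_nonneg _),
    ofReal_integral_eq_lintegral_ofReal]
  · refine setLIntegral_congr_fun measurableSet_Ioi fun t ht => ?_
    have ht : 0 < t := ht
    simp only [Kf]
    rw [ENNReal.ofReal_mul (Real.rpow_nonneg ht.le _)]
  · exact Kf_int hs hs1 _
  · refine (ae_restrict_iff' measurableSet_Ioi).2 (ae_of_all _ fun t ht => Kf_nonneg s _ ht)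

lemma levy_far {s : ℝ} (hs : 0 < s) {r : ℝ} (hr : 0 < r) :
    ((tau s).prod (gam d)) {z | r < z.1} < ⊤ := by
  have e : {z : ℝ × Pt d | r < z.1} = Ioi r ×ˢ univ := by ext; simp
  rw [e, Measure.prod_prod]
  simp only [measure_univ, mul_one]
  rw [tau, withDensity_apply _ measurableSet_Ioi, Measure.restrict_restrict measurableSet_Ioi,
    Set.inter_eq_left.2 (Ioi_subset_Ioi hr.le)]
  exact (integrableOn_Ioi_rpow_of_lt (a := -1 - 2 * s) (by linarith) hr).lintegral_lt_top

lemma gam_moment (m : ℕ) (hm : m ≠ 0) : ∫⁻ y, ‖y‖ₑ ^ m ∂(gam d) < ⊤ := by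
  have h : MemLp (fun y : Pt d => y) (m : ENNReal) (gam d) := by
    refine MemLp.of_eval fun i => ?_
    have h1 := ProbabilityTheory.memLp_id_gaussianReal' (μ := 0) (v := 1) (m : ENNReal) (by simp)
    exact h1.comp_measurePreserving (measurePreserving_eval
      (fun _ : Fin d => ProbabilityTheory.gaussianReal 0 1) i)
  have := lintegral_rpow_enorm_lt_top_of_eLpNorm_lt_top (p := (m : ENNReal)) (by simpa using hm)
    (by simp) h.2
  simpa using this

lemma levy_near {s : ℝ} (m : ℕ) (hm : m ≠ 0) (hsm : 2 * s < m) {ε : ENNReal}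
    (hε : 0 < ε) : ∃ r : ℝ, 0 < r ∧
    ∫⁻ z in {z | z.1 ≤ r}, ‖z.1 • z.2‖ₑ ^ m ∂((tau s).prod (gam d)) ≤ ε := by
  set b : ℝ := m - 2 * s with hb
  have hb0 : 0 < b := by linarith
  set M := ∫⁻ y, ‖y‖ₑ ^ m ∂(gam d)
  have hM : M < ⊤ := gam_moment m hm
  have key : ∀ r : ℝ, 0 < r →
      ∫⁻ z in {z | z.1 ≤ r}, ‖z.1 • z.2‖ₑ ^ m ∂((tau s).prod (gam d)) =
        ENNReal.ofReal (r ^ b / b) * M := by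
    intro r hr
    have e : {z : ℝ × Pt d | z.1 ≤ r} = Iic r ×ˢ univ := by ext; simp
    rw [e, ← Measure.prod_restrict, Measure.restrict_univ]
    simp_rw [enorm_smul, mul_pow]
    rw [lintegral_prod_mul (f := fun t : ℝ => ‖t‖ₑ ^ m) (g := fun y : Pt d => ‖y‖ₑ ^ m)
      (by fun_prop) (by fun_prop)]
    congr 1
    rw [tau, restrict_withDensity measurableSet_Iic, Measure.restrict_restrict measurableSet_Iic,
      Iic_inter_Ioi, lintegral_withDensity_eq_lintegral_mul _ (by fun_prop) (by fun_prop)]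
    have hI : ∫ t in Ioc 0 r, t ^ (b - 1) = r ^ b / b := by
      rw [← intervalIntegral.integral_of_le hr.le, integral_rpow (Or.inl (by linarith))]
      rw [sub_add_cancel, Real.zero_rpow hb0.ne', sub_zero]
    rw [← hI, ofReal_integral_eq_lintegral_ofReal (intOn_rpow (by linarith) hr.le)]
    · refine setLIntegral_congr_fun measurableSet_Ioc fun t ht => ?_
      have ht0 : 0 < t := ht.1
      simp only [Pi.mul_apply]
      rw [Real.enorm_eq_ofReal ht0.le, ← ENNReal.ofReal_pow ht0.le, ← ENNReal.ofReal_mul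
        (Real.rpow_nonneg ht0.le _), ← Real.rpow_natCast t m, ← Real.rpow_add ht0]
      congr 2; rw [hb]; ring
    · exact (ae_restrict_iff' measurableSet_Ioc).2
        (ae_of_all _ fun t ht => Real.rpow_nonneg ht.1.le _)
  have hlim : Tendsto (fun r : ℝ => ENNReal.ofReal (r ^ b / b) * M) (𝓝[>] 0) (𝓝 0) := by
    have h1 : Tendsto (fun r : ℝ => r ^ b / b) (𝓝[>] 0) (𝓝 0) := by
      have : ContinuousAt (fun r : ℝ => r ^ b / b) 0 :=
        (Real.continuousAt_rpow_const 0 b (Or.inr hb0.le)).div_const b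
      have := this.tendsto.mono_left (nhdsWithin_le_nhds (s := Ioi 0))
      simpa [Real.zero_rpow hb0.ne'] using this
    have h2 := ENNReal.tendsto_ofReal h1
    have h3 := ENNReal.Tendsto.mul_const h2 (Or.inr hM.ne)
    simpa using h3
  obtain ⟨r, hr1, hr2⟩ := ((hlim.eventually_lt_const hε).and self_mem_nhdsWithin).exists
  exact ⟨r, hr2, (key r hr2).le.trans hr1.le⟩

end FracMFG


namespace FracMFG
variable {d : ℕ}

lemma fChar_add_neg (k : Fin d → ℤ) (h : Pt d) :
    fChar k h + fChar k (-h) = 2 * ((Real.cos (2 * π * ∑ i, (k i : ℝ) * h i) : ℝ) : ℂ) := by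
  rw [Complex.ofReal_cos, Complex.two_cos, fChar, fChar]
  congr 2
  · push_cast; ring
  · simp only [Pi.neg_apply, mul_neg, Finset.sum_neg_distrib]; push_cast; ring

lemma one_le_normZ {k : Fin d → ℤ} (hk : k ≠ 0) : 1 ≤ normZ k := by
  obtain ⟨i, hi⟩ := Function.ne_iff.1 hk
  rw [normZ, Real.one_le_sqrt]
  have h1 : (1 : ℝ) ≤ (k i : ℝ) ^ 2 := by
    have : (1 : ℤ) ≤ (k i) ^ 2 := by
      have := sq_pos_of_ne_zero (a := k i) (by simpa using hi)
      omega
    exact_mod_cast this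
  exact h1.trans (Finset.single_le_sum (f := fun i => (k i : ℝ) ^ 2)
    (fun i _ => sq_nonneg _) (Finset.mem_univ i))

lemma summable_coeff {s : ℝ} (hs : 0 < s) (u : Pt d → ℝ)
    (hsum : Summable fun k : Fin d → ℤ => normZ k ^ (2 * s) * ‖fCoeff u k‖) :
    Summable fun k => fCoeff u k := by
  refine Summable.of_norm_bounded_eventually hsum ?_
  have : ({0}ᶜ : Set (Fin d → ℤ)) ∈ (cofinite : Filter (Fin d → ℤ)) :=
    (Set.finite_singleton _).compl_mem_cofinite
  filter_upwards [this] with k hk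
  have h1 : 1 ≤ normZ k ^ (2 * s) := Real.one_le_rpow (one_le_normZ hk) (by linarith)
  nlinarith [norm_nonneg (fCoeff u k)]

lemma levy_integrable {s : ℝ} (hs : 0 < s) (hs1 : s < 1) (k : Fin d → ℤ) :
    Integrable (fun z : ℝ × Pt d => 1 - Real.cos (2 * π * ∑ i, (k i : ℝ) * (z.1 • z.2) i))
      ((tau s).prod (gam d)) ∧
    ∫ z : ℝ × Pt d, (1 - Real.cos (2 * π * ∑ i, (k i : ℝ) * (z.1 • z.2) i))
      ∂((tau s).prod (gam d)) = normZ k ^ (2 * s) * cs s := by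
  have hm : Measurable fun z : ℝ × Pt d =>
      (1 - Real.cos (2 * π * ∑ i, (k i : ℝ) * (z.1 • z.2) i)) := by
    simp only [Pi.smul_apply, smul_eq_mul]; fun_prop
  have h0 : ∀ z : ℝ × Pt d, 0 ≤ 1 - Real.cos (2 * π * ∑ i, (k i : ℝ) * (z.1 • z.2) i) :=
    fun z => by linarith [Real.cos_le_one (2 * π * ∑ i, (k i : ℝ) * (z.1 • z.2) i)]
  have hl := levy_lint (d := d) hs hs1 k
  constructor
  · refine ⟨hm.aestronglyMeasurable, ?_⟩
    rw [hasFiniteIntegral_iff_ofReal (ae_of_all _ h0), hl]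
    exact ENNReal.ofReal_lt_top
  · rw [integral_eq_lintegral_of_nonneg_ae (ae_of_all _ h0) hm.aestronglyMeasurable, hl,
      ENNReal.toReal_ofReal]
    exact mul_nonneg (Real.rpow_nonneg (Real.sqrt_nonneg _) _) (cs_pos hs hs1).le

lemma repr_bound {s : ℝ} (hs : 0 < s) (hs1 : s < 1) (u : Pt d → ℝ) (hu : Continuous u)
    (hper : IsPeriodicF u)
    (hsum : Summable fun k : Fin d → ℤ => normZ k ^ (2 * s) * ‖fCoeff u k‖) (x : Pt d) :
    ‖fracLap s u x‖ₑ ≤ ENNReal.ofReal ((2 * π) ^ (2 * s) / (2 * cs s)) *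
      ∫⁻ z : ℝ × Pt d, ‖u (x + z.1 • z.2) + u (x - z.1 • z.2) - 2 * u x‖ₑ
        ∂((tau s).prod (gam d)) := by
  have hc := cs_pos hs hs1
  have hco := summable_coeff hs u hsum
  set ν := (tau s).prod (gam d)
  let c : (Fin d → ℤ) → ℝ × Pt d → ℝ :=
    fun k z => 1 - Real.cos (2 * π * ∑ i, (k i : ℝ) * (z.1 • z.2) i)
  have hc0 : ∀ k z, 0 ≤ c k z :=
    fun k z => by linarith [Real.cos_le_one (2 * π * ∑ i, (k i : ℝ) * (z.1 • z.2) i)]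
  let F : (Fin d → ℤ) → ℝ × Pt d → ℂ :=
    fun k z => (2 * (fCoeff u k * fChar k x)) * (c k z : ℂ)
  have hF : ∀ z : ℝ × Pt d, HasSum (fun k => F k z)
      ((-(u (x + z.1 • z.2) + u (x - z.1 • z.2) - 2 * u x) : ℝ) : ℂ) := by
    intro z
    have h1 := fourier_inversion u hu hper hco (x + z.1 • z.2)
    have h2 := fourier_inversion u hu hper hco (x - z.1 • z.2)
    have h3 := (fourier_inversion u hu hper hco x).mul_left 2
    have h4 := h3.sub (h1.add h2)
    convert! h4 using 1
    · ext k
      have e := fChar_add_neg k (z.1 • z.2)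
      simp only [F, c]
      rw [sub_eq_add_neg x, fChar_add, fChar_add]
      push_cast at e ⊢
      linear_combination (fCoeff u k * fChar k x) * e
    · push_cast; ring
  have hFi : ∀ k, Integrable (F k) ν := fun k =>
    ((levy_integrable hs hs1 k).1.ofReal (𝕜 := ℂ)).const_mul _
  have hnorm : ∀ k, ∫ z, ‖F k z‖ ∂ν = 2 * cs s * (normZ k ^ (2 * s) * ‖fCoeff u k‖) := by
    intro k
    have : ∀ z, ‖F k z‖ = 2 * ‖fCoeff u k‖ * c k z := by
      intro z
      simp only [F, norm_mul, norm_fChar, Complex.norm_real, Real.norm_of_nonneg (hc0 k z)]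
      simp
    simp_rw [this]
    rw [integral_const_mul, (levy_integrable hs hs1 k).2]; ring
  have key := hasSum_integral_of_summable_integral_norm hFi
    (by simp_rw [hnorm]; exact hsum.mul_left _)
  have hval : ∀ k, ∫ z, F k z ∂ν =
      (2 * cs s : ℝ) * (((normZ k ^ (2*s) : ℝ) : ℂ) * fCoeff u k * fChar k x) := by
    intro k
    simp only [F]
    rw [integral_const_mul, integral_complex_ofReal, (levy_integrable hs hs1 k).2]
    push_cast; ring
  simp_rw [hval] at key
  have h5 := key.tsum_eq
  rw [tsum_mul_left] at h5
  simp_rw [fun z => (hF z).tsum_eq] at h5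
  rw [integral_complex_ofReal] at h5
  have h6 : fracLap s u x = ((2 * π) ^ (2 * s) / (2 * cs s)) *
      ∫ z : ℝ × Pt d, -(u (x + z.1 • z.2) + u (x - z.1 • z.2) - 2 * u x) ∂ν := by
    rw [fracLap, Complex.re_ofReal_mul]
    have h7 := congrArg Complex.re h5
    rw [Complex.re_ofReal_mul] at h7
    simp only [RCLike.ofReal_eq_complex_ofReal, Complex.ofReal_re] at h7
    rw [← h7]
    field_simp
  rw [h6, enorm_mul, Real.enorm_of_nonneg (by positivity)]
  gcongr
  refine (enorm_integral_le_lintegral_enorm _).trans ?_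
  simp only [enorm_neg, le_refl]

lemma far_diff {p : ℝ} (hp : 1 < p) (u : Pt d → ℝ) (hu : Continuous u) (hper : IsPeriodicF u)
    (h : Pt d) :
    ∫⁻ x in torusBox d, ‖u (x + h) + u (x - h) - 2 * u x‖ₑ ^ p ≤
      4 ^ p * ∫⁻ x in torusBox d, ‖u x‖ₑ ^ p := by
  let e : Fin 4 → ℝ := ![1, -1, 0, 0]
  have hm : Measurable (Function.uncurry fun (x : Pt d) (j : Fin 4) => ‖u (x + e j • h)‖ₑ) := by
    have he : Measurable e := Measurable.of_discrete
    have : Measurable fun q : Pt d × Fin 4 => q.1 + e q.2 • h :=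
      measurable_fst.add ((he.comp measurable_snd).smul_const h)
    exact (hu.measurable.comp this).enorm
  have := minkowski_lint (volume.restrict (torusBox d)) (Measure.count : Measure (Fin 4)) hp
    (fun _ => 1) measurable_const (fun x j => ‖u (x + e j • h)‖ₑ) hm
    (∫⁻ x in torusBox d, ‖u x‖ₑ ^ p) (fun j => by
      refine (lint_translate (fun x => ‖u x‖ₑ ^ p) ?_ (e j • h)).le
      intro k x
      simp only [hper k x])
  simp only [one_mul, lintegral_count, tsum_fintype, Fin.sum_univ_four, e] at this
  have e4 : (1 + 1 + 1 + 1 : ENNReal) = 4 := by norm_num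
  rw [e4] at this
  refine le_trans (lintegral_mono fun x => ?_) this
  gcongr
  simp only [Matrix.cons_val_zero, Matrix.cons_val_one, Matrix.cons_val]
  simp only [one_smul, neg_smul, zero_smul, add_zero]
  calc _ = ‖(u (x + h) + u (x + -h)) - (u x + u x)‖ₑ := by
        congr 1; rw [sub_eq_add_neg x]; ring
    _ ≤ (‖u (x + h)‖ₑ + ‖u (x + -h)‖ₑ) + (‖u x‖ₑ + ‖u x‖ₑ) := by
        refine enorm_sub_le.trans ?_
        gcongr <;> exact enorm_add_le _ _
    _ = _ := by ring

lemma near_diff {p : ℝ} (hp : 1 < p) (G : Pt d → ℝ) (hG : Measurable G) (hper : IsPeriodicF G)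
    (h : Pt d) :
    ∫⁻ x in torusBox d, (∫⁻ t in Ioc (-1 : ℝ) 1, ‖G (x + t • h)‖ₑ) ^ p ≤
      2 ^ p * ∫⁻ x in torusBox d, ‖G x‖ₑ ^ p := by
  have hm : Measurable (Function.uncurry fun (x : Pt d) (t : ℝ) => ‖G (x + t • h)‖ₑ) := by
    have : Measurable fun q : Pt d × ℝ => q.1 + q.2 • h := by fun_prop
    exact (hG.comp this).enorm
  have := minkowski_lint (volume.restrict (torusBox d)) (volume.restrict (Ioc (-1 : ℝ) 1)) hp
    (fun _ => 1) measurable_const (fun x t => ‖G (x + t • h)‖ₑ) hm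
    (∫⁻ x in torusBox d, ‖G x‖ₑ ^ p) (fun t => by
      refine (lint_translate (fun x => ‖G x‖ₑ ^ p) ?_ (t • h)).le
      intro k x
      simp only [hper k x])
  simp only [one_mul, lintegral_one, Measure.restrict_apply_univ, Real.volume_Ioc] at this
  have e : ENNReal.ofReal (1 - (-1)) = 2 := by norm_num
  rwa [e] at this

/-- The extended `L^p` norm on the torus. -/
def eN (p : ℝ) (f : Pt d → ENNReal) : ENNReal := (∫⁻ x in torusBox d, f x ^ p) ^ (1 / p)

lemma eN_add {p : ℝ} (hp : 1 < p) (f g : Pt d → ENNReal) (hf : Measurable f)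
    (hg : Measurable g) : eN p (fun x => f x + g x) ≤ eN p f + eN p g :=
  ENNReal.lintegral_Lp_add_le hf.aemeasurable hg.aemeasurable hp.le

lemma eN_mono {p : ℝ} (hp : 1 < p) (f g : Pt d → ENNReal) (h : ∀ x, f x ≤ g x) :
    eN p f ≤ eN p g := by
  have : 0 < p := by linarith
  unfold eN
  gcongr
  exact h _

lemma eN_const_mul {p : ℝ} (hp : 1 < p) (c : ENNReal) (hc : c ≠ ⊤) (f : Pt d → ENNReal) :
    eN p (fun x => c * f x) = c * eN p f := by
  have hp0 : 0 < p := by linarith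
  unfold eN
  simp_rw [ENNReal.mul_rpow_of_nonneg _ _ hp0.le]
  rw [lintegral_const_mul' _ _ (ENNReal.rpow_ne_top_of_nonneg hp0.le hc),
    ENNReal.mul_rpow_of_nonneg _ _ (by positivity), ← ENNReal.rpow_mul, mul_one_div_cancel hp0.ne',
    ENNReal.rpow_one]

lemma eN_le {p : ℝ} (hp : 1 < p) (c : ENNReal) (f g : Pt d → ENNReal)
    (h : ∫⁻ x in torusBox d, f x ^ p ≤ c ^ p * ∫⁻ x in torusBox d, g x ^ p) :
    eN p f ≤ c * eN p g := by
  have hp0 : 0 < p := by linarith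
  unfold eN
  refine (ENNReal.rpow_le_rpow h (by positivity)).trans ?_
  rw [ENNReal.mul_rpow_of_nonneg _ _ (by positivity), ← ENNReal.rpow_mul, mul_one_div_cancel hp0.ne',
    ENNReal.rpow_one]

lemma lpNorm_eq {p : ℝ} (hp : 1 < p) (f : Pt d → ℝ) (hf : Measurable f) :
    lpNorm p f = (eN p fun x => ‖f x‖ₑ).toReal := by
  have hp0 : 0 < p := by linarith
  rw [lpNorm, eN, ← ENNReal.toReal_rpow, integral_eq_lintegral_of_nonneg_ae]
  · congr 3
    ext x
    rw [Real.enorm_eq_ofReal_abs, ENNReal.ofReal_rpow_of_nonneg (abs_nonneg _) hp0.le]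
  · exact ae_of_all _ fun x => Real.rpow_nonneg (abs_nonneg _) _
  · exact ((continuous_abs.measurable.comp hf).pow_const p).aestronglyMeasurable

lemma eN_ne_top {p : ℝ} (hp : 1 < p) (f : Pt d → ℝ)
    (hi : IntegrableOn (fun x => |f x| ^ p) (torusBox d)) : (eN p fun x => ‖f x‖ₑ) ≠ ⊤ := by
  have hp0 : 0 < p := by linarith
  refine ENNReal.rpow_ne_top_of_nonneg (by positivity) ?_
  have := hi.2
  rw [hasFiniteIntegral_iff_ofReal
    (ae_of_all _ fun x => Real.rpow_nonneg (abs_nonneg _) _)] at this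
  convert! this.ne using 3
  beta_reduce
  rw [Real.enorm_eq_ofReal_abs, ENNReal.ofReal_rpow_of_nonneg (abs_nonneg _) hp0.le]

lemma fracLap_meas (s : ℝ) (u : Pt d → ℝ)
    (hsum : Summable fun k : Fin d → ℤ => normZ k ^ (2 * s) * ‖fCoeff u k‖) :
    Continuous (fracLap s u) := by
  unfold fracLap
  refine Complex.continuous_re.comp (continuous_const.mul ?_)
  refine continuous_tsum (u := fun k => normZ k ^ (2 * s) * ‖fCoeff u k‖) ?_ hsum ?_
  · intro k
    unfold fChar
    fun_prop
  · intro k x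
    rw [norm_mul, norm_mul, norm_fChar, Complex.norm_real, mul_one, Real.norm_of_nonneg]
    exact Real.rpow_nonneg (Real.sqrt_nonneg _) _

lemma fracLap_zero (s : ℝ) (u : Pt d → ℝ)
    (hsum : ¬ Summable fun k : Fin d → ℤ => normZ k ^ (2 * s) * ‖fCoeff u k‖) (x : Pt d) :
    fracLap s u x = 0 := by
  rw [fracLap, tsum_eq_zero_of_not_summable]
  · simp
  · intro h
    apply hsum
    refine h.norm.congr fun k => ?_
    rw [norm_mul, norm_mul, norm_fChar, Complex.norm_real, mul_one, Real.norm_of_nonneg]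
    exact Real.rpow_nonneg (Real.sqrt_nonneg _) _

lemma lpNorm_nonneg (p : ℝ) (f : Pt d → ℝ) : 0 ≤ lpNorm p f :=
  Real.rpow_nonneg (integral_nonneg fun x => Real.rpow_nonneg (abs_nonneg _) _) _

lemma main_est (p : ℝ) (hp : 1 < p) (s : ℝ) (hs : 0 < s) (hs1 : s < 1) (m : ℕ) (hm : m ≠ 0)
    (hsm : 2 * s < m) (δ : ℝ) (hδ : 0 < δ) :
    ∃ C > 0, ∀ (u G : Pt d → ℝ), IsPeriodicF u → Continuous u → IsPeriodicF G → Measurable G →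
      IntegrableOn (fun x => |u x| ^ p) (torusBox d) →
      IntegrableOn (fun x => |G x| ^ p) (torusBox d) →
      (∀ x h, ‖u (x + h) + u (x - h) - 2 * u x‖ₑ ≤
        ‖h‖ₑ ^ m * ∫⁻ t in Ioc (-1 : ℝ) 1, ‖G (x + t • h)‖ₑ) →
      lpNorm p (fracLap s u) ≤ δ * lpNorm p G + C * lpNorm p u := by
  have hc := cs_pos hs hs1
  have hp0 : 0 < p := by linarith
  set κ : ℝ := (2 * π) ^ (2 * s) / (2 * cs s) with hκ
  have hκ0 : 0 < κ := by positivity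
  obtain ⟨r, hr, hnear⟩ := levy_near (d := d) (s := s) m hm hsm
    (ε := ENNReal.ofReal (δ / (2 * κ))) (by simp; positivity)
  set ν := (tau s).prod (gam d) with hν
  have hfar : ν {z | r < z.1} < ⊤ := levy_far hs hr
  set V := ν {z | r < z.1} with hV
  refine ⟨κ * (4 * V.toReal) + 1, by positivity, ?_⟩
  intro u G hup huc hGp hGm hui hGi hb
  have hRHS : 0 ≤ δ * lpNorm p G + (κ * (4 * V.toReal) + 1) * lpNorm p u := by
    have := lpNorm_nonneg p G
    have := lpNorm_nonneg p u
    positivity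
  by_cases hsum : Summable fun k : Fin d → ℤ => normZ k ^ (2 * s) * ‖fCoeff u k‖
  swap
  · have : fracLap s u = fun _ => 0 := funext (fracLap_zero s u hsum)
    rw [this]
    have : lpNorm p (fun _ : Pt d => (0 : ℝ)) = 0 := by
      simp [lpNorm, Real.zero_rpow hp0.ne', hp0.ne']
    rw [this]
    exact hRHS
  let D : Pt d → ℝ × Pt d → ENNReal :=
    fun x z => ‖u (x + z.1 • z.2) + u (x - z.1 • z.2) - 2 * u x‖ₑ
  have hD : Measurable (Function.uncurry D) := by
    have : Continuous fun q : Pt d × (ℝ × Pt d) =>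
      u (q.1 + q.2.1 • q.2.2) + u (q.1 - q.2.1 • q.2.2) - 2 * u q.1 := by fun_prop
    exact this.measurable.enorm
  let g : Pt d → ℝ × Pt d → ENNReal :=
    fun x z => ∫⁻ t in Ioc (-1 : ℝ) 1, ‖G (x + t • (z.1 • z.2))‖ₑ
  have hg : Measurable (Function.uncurry g) := by
    have h1 : Measurable fun q : (Pt d × (ℝ × Pt d)) × ℝ =>
        q.1.1 + q.2 • (q.1.2.1 • q.1.2.2) := by fun_prop
    exact Measurable.lintegral_prod_right' (f := fun q : (Pt d × (ℝ × Pt d)) × ℝ =>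
        ‖G (q.1.1 + q.2 • (q.1.2.1 • q.1.2.2))‖ₑ) (hGm.comp h1).enorm
  let Na : Pt d → ENNReal := fun x => ∫⁻ z in {z | z.1 ≤ r}, D x z ∂ν
  let Fa : Pt d → ENNReal := fun x => ∫⁻ z in {z | r < z.1}, D x z ∂ν
  have hNam : Measurable Na := Measurable.lintegral_prod_right' hD
  have hFam : Measurable Fa := Measurable.lintegral_prod_right' hD
  have hpt : ∀ x, ‖fracLap s u x‖ₑ ≤ ENNReal.ofReal κ * (Na x + Fa x) := by
    intro x
    refine (repr_bound hs hs1 u huc hup hsum x).trans ?_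
    gcongr
    have hms : MeasurableSet {z : ℝ × Pt d | z.1 ≤ r} :=
      measurableSet_le measurable_fst measurable_const
    have hcompl : {z : ℝ × Pt d | z.1 ≤ r}ᶜ = {z | r < z.1} := by ext; simp
    have := lintegral_add_compl (μ := ν) (D x) hms
    rw [hcompl] at this
    exact this.ge
  have hNa : eN p Na ≤ ENNReal.ofReal (δ / (2 * κ)) * (2 * eN p fun x => ‖G x‖ₑ) := by
    have h1 : eN p Na ≤ (ENNReal.ofReal (δ / (2 * κ)) * 2) * eN p fun x => ‖G x‖ₑ := by
      refine eN_le hp _ _ _ ?_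
      have := minkowski_lint (volume.restrict (torusBox d)) (ν.restrict {z | z.1 ≤ r}) hp
        (fun z => ‖z.1 • z.2‖ₑ ^ m) (by fun_prop) g hg
        (2 ^ p * ∫⁻ x in torusBox d, ‖G x‖ₑ ^ p) (fun z => near_diff hp G hGm hGp _)
      refine le_trans (lintegral_mono fun x => ?_) (this.trans ?_)
      · gcongr
        exact lintegral_mono fun z => hb x _
      · rw [ENNReal.mul_rpow_of_nonneg _ _ hp0.le, mul_assoc]
        gcongr
    rwa [mul_assoc] at h1
  have hFa : eN p Fa ≤ V * 4 * eN p fun x => ‖u x‖ₑ := by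
    refine eN_le hp _ _ _ ?_
    have := minkowski_lint (volume.restrict (torusBox d)) (ν.restrict {z | r < z.1}) hp
      (fun z => 1) measurable_const D hD
      (4 ^ p * ∫⁻ x in torusBox d, ‖u x‖ₑ ^ p) (fun z => far_diff hp u huc hup _)
    simp only [one_mul, lintegral_one, Measure.restrict_apply_univ] at this
    rw [ENNReal.mul_rpow_of_nonneg _ _ hp0.le, mul_assoc]
    exact this
  have hGt := eN_ne_top hp G hGi
  have hUt := eN_ne_top hp u hui
  rw [lpNorm_eq hp _ (fracLap_meas s u hsum).measurable, lpNorm_eq hp G hGm,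
    lpNorm_eq hp u huc.measurable]
  set NG := eN p fun x => ‖G x‖ₑ
  set NU := eN p fun x => ‖u x‖ₑ
  have hfin : (eN p fun x => ‖fracLap s u x‖ₑ) ≤
      ENNReal.ofReal κ * (ENNReal.ofReal (δ / (2 * κ)) * (2 * NG) + V * 4 * NU) := by
    refine (eN_mono hp _ _ hpt).trans ?_
    rw [eN_const_mul hp _ ENNReal.ofReal_ne_top]
    gcongr
    exact (eN_add hp Na Fa hNam hFam).trans (add_le_add hNa hFa)
  have h1 : ENNReal.ofReal (δ / (2 * κ)) * (2 * NG) ≠ ⊤ :=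
    ENNReal.mul_ne_top ENNReal.ofReal_ne_top (ENNReal.mul_ne_top (by simp) hGt)
  have h2 : V * 4 * NU ≠ ⊤ :=
    ENNReal.mul_ne_top (ENNReal.mul_ne_top hfar.ne (by simp)) hUt
  have := ENNReal.toReal_mono
    (ENNReal.mul_ne_top ENNReal.ofReal_ne_top (ENNReal.add_ne_top.2 ⟨h1, h2⟩)) hfin
  refine this.trans ?_
  rw [ENNReal.toReal_mul, ENNReal.toReal_add h1 h2, ENNReal.toReal_ofReal hκ0.le]
  simp only [ENNReal.toReal_mul, ENNReal.toReal_ofReal (show 0 ≤ δ / (2 * κ) by positivity)]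
  have hNU : 0 ≤ NU.toReal := ENNReal.toReal_nonneg
  have e : κ * (δ / (2 * κ) * (2 * NG.toReal)) = δ * NG.toReal := by field_simp
  norm_num
  nlinarith

lemma periodic_fderiv {E : Type*} [NormedAddCommGroup E] [NormedSpace ℝ E] (u : Pt d → E)
    (hu : IsPeriodicF u) : IsPeriodicF (fderiv ℝ u) := by
  intro k x
  have h1 : (fun y : Pt d => u (y + fun i => (k i : ℝ))) = u := by
    funext y; exact hu k y
  have h2 := fderiv_comp_add_right (𝕜 := ℝ) (f := u) (x := x) (fun i => (k i : ℝ))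
  rw [h1] at h2
  exact h2.symm

end FracMFG

/-- Interpolation estimates for the fractional Laplacian in `L^p(𝕋^d)`:
(i) for `s ∈ (0,1/2)`, `‖(-Δ)^s u‖_p ≤ δ‖Du‖_p + C(δ)‖u‖_p`;
(ii) for `s ∈ [1/2,1)`, `‖(-Δ)^s u‖_p ≤ δ‖D²u‖_p + C(δ)‖u‖_p`. -/
theorem fracLap_lp_interpolation (d : ℕ) (p : ℝ) (hp : 1 < p) (s : ℝ) :
    (s ∈ Set.Ioo (0:ℝ) (1/2) →
      ∀ δ : ℝ, 0 < δ → ∃ C > 0, ∀ u : Pt d → ℝ, IsPeriodicF u →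
        IntegrableOn (fun x => |u x| ^ p) (torusBox d) →
        Differentiable ℝ u →
        IntegrableOn (fun x => ‖fderiv ℝ u x‖ ^ p) (torusBox d) →
        lpNorm p (fracLap s u) ≤ δ * lpNorm p (fun x => ‖fderiv ℝ u x‖) + C * lpNorm p u) ∧
    (s ∈ Set.Ico (1/2 : ℝ) 1 →
      ∀ δ : ℝ, 0 < δ → ∃ C > 0, ∀ u : Pt d → ℝ, IsPeriodicF u →
        IntegrableOn (fun x => |u x| ^ p) (torusBox d) →
        Differentiable ℝ u → Differentiable ℝ (fderiv ℝ u) →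
        IntegrableOn (fun x => ‖iteratedFDeriv ℝ 2 u x‖ ^ p) (torusBox d) →
        lpNorm p (fracLap s u) ≤
          δ * lpNorm p (fun x => ‖iteratedFDeriv ℝ 2 u x‖) + C * lpNorm p u) := by
  constructor
  · rintro ⟨hs, hs2⟩ δ hδ
    obtain ⟨C, hC, h⟩ := main_est (d := d) p hp s hs (by linarith) 1 one_ne_zero
      (by push_cast; linarith) δ hδ
    refine ⟨C, hC, fun u hper hui hd hGi => ?_⟩
    refine h u (fun x => ‖fderiv ℝ u x‖) hper hd.continuous ?_ ?_ hui (by simpa using hGi) ?_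
    · intro k x
      simp only [periodic_fderiv u hper k x]
    · exact (measurable_fderiv ℝ u).norm
    · intro x h
      simpa only [enorm_norm] using diff_bound_one u hd x h
  · rintro ⟨hs, hs2⟩ δ hδ
    obtain ⟨C, hC, h⟩ := main_est (d := d) p hp s (by linarith) hs2 2 two_ne_zero
      (by push_cast; linarith) δ hδ
    refine ⟨C, hC, fun u hper hui hd hd2 hGi => ?_⟩
    simp only [enorm_iter_two] at hGi ⊢
    refine h u (fun x => ‖fderiv ℝ (fderiv ℝ u) x‖) hper hd.continuous ?_ ?_ hui
      (by
        have e : ∀ x, |‖fderiv ℝ (fderiv ℝ u) x‖| = ‖fderiv ℝ (fderiv ℝ u) x‖ :=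
          fun x => abs_of_nonneg (norm_nonneg (fderiv ℝ (fderiv ℝ u) x))
        simp only [e]
        exact hGi) ?_
    · intro k x
      simp only [periodic_fderiv _ (periodic_fderiv u hper) k x]
    · exact (measurable_fderiv ℝ (fderiv ℝ u)).norm
    · intro x h
      refine (diff_bound_two u hd hd2 x h).trans_eq ?_
      congr 1
      refine lintegral_congr fun t => ?_
      exact (enorm_norm _).symm
end
end

section
/- Let σ ≥ 0, s ∈ (0,1), and assume V ∈ C^{2+α,1+α/2}(Q_T), that H satisfies (H1) and (H3)–(H5), and ‖V‖_{C²_x(Q_T)} + ‖u_T‖_{C²(T^d)} ≤ K for some K > 0. Then every classical solution u of the backward equation −∂_t u − σΔu + (−Δ)^s u + H(x, Du) = V(x,t) in Q_T, u(·,T) = u_T, satisfies the semiconcavity estimate D²u(x,t) ≤ C·I on Q_T (in the sense of symmetric matrices), where C depends only on K and not on σ. -/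
open MeasureTheory Real Set Filter
open scoped Topology

noncomputable section

namespace FracMFG

/-- Classical solution of the backward (possibly viscous) fractional HJB equation
`-∂_t u - σΔu + (-Δ)^s u + H(x,Du) = V`, `u(T) = u_T`. -/
structure IsClassicalSolHJB (d : ℕ) (s σ T : ℝ) (H : Pt d → Pt d → ℝ)
    (V : Pt d → ℝ → ℝ) (uT : Pt d → ℝ) (u : Pt d → ℝ → ℝ) : Prop where
  per : ∀ t, IsPeriodicF fun x => u x t
  cont : ContinuousOn (fun z : Pt d × ℝ => u z.1 z.2) (Set.univ ×ˢ Set.Icc 0 T)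
  smooth_x : ∀ t, ContDiff ℝ 2 fun x => u x t
  diff_t : ∀ x, ∀ t ∈ Set.Ioo (0:ℝ) T, DifferentiableAt ℝ (u x) t
  eq : ∀ x : Pt d, ∀ t ∈ Set.Ioo (0:ℝ) T,
    -tDeriv u x t - σ * lap (fun y => u y t) x + fracLap s (fun y => u y t) x
      + H x (grad (fun y => u y t) x) = V x t
  final : ∀ x, u x T = uT x

end FracMFG

open FracMFG


theorem sc_fChar_norm {d : ℕ} (k : Fin d → ℤ) (x : Pt d) : ‖fChar k x‖ = 1 := by
  unfold fChar
  have : 2 * (π : ℂ) * Complex.I * ((∑ i, (k i : ℝ) * x i : ℝ) : ℂ)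
      = ((2 * π * (∑ i, (k i : ℝ) * x i) : ℝ) : ℂ) * Complex.I := by
    push_cast; ring
  rw [this, Complex.norm_exp_ofReal_mul_I]

theorem sc_fChar_add {d : ℕ} (k : Fin d → ℤ) (x y : Pt d) :
    fChar k (x + y) = fChar k x * fChar k y := by
  unfold fChar
  rw [← Complex.exp_add]
  congr 1
  simp only [Pi.add_apply, mul_add, Finset.sum_add_distrib]
  push_cast; ring

theorem sc_fChar_cont {d : ℕ} (k : Fin d → ℤ) : Continuous (fChar k) := by
  unfold fChar
  fun_prop

theorem sc_mFourier {d : ℕ} (k : Fin d → ℤ) (x : Pt d) :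
    UnitAddTorus.mFourier k (fun i => ((x i : ℝ) : UnitAddCircle)) = fChar k x := by
  simp only [UnitAddTorus.mFourier, ContinuousMap.coe_mk, fourier_coe_apply]
  rw [← Complex.exp_sum]
  unfold fChar
  congr 1
  push_cast
  rw [Finset.mul_sum]
  refine Finset.sum_congr rfl fun i _ => ?_
  simp; ring

/-- Fourier inversion for continuous periodic functions with summable coefficients. -/
theorem sc_inversion {d : ℕ} (u : Pt d → ℝ) (hu : Continuous u) (hp : IsPeriodicF u)
    (hs : Summable (fCoeff u)) (x : Pt d) :
    HasSum (fun k => fCoeff u k * fChar k x) (u x : ℂ) := by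
  set q : Pt d → UnitAddTorus (Fin d) := Pi.map fun _ => ((↑) : ℝ → UnitAddCircle) with hq
  have hqq : IsOpenQuotientMap q :=
    IsOpenQuotientMap.piMap fun _ => QuotientAddGroup.isOpenQuotientMap_mk
  have hfq : ∀ y : Pt d, u (fun i => Int.fract (y i)) = u y := by
    intro y
    have := hp (fun i => -⌊y i⌋) y
    rw [← this]
    congr 1
    funext i
    rw [Int.fract]; push_cast; ring
  set f : UnitAddTorus (Fin d) → ℂ :=
    fun z => (u (fun i => (AddCircle.equivIco (1:ℝ) 0 (z i) : ℝ)) : ℂ) with hf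
  have hfu : ∀ y : Pt d, f (q y) = u y := by
    intro y
    simp only [hf, hq, Pi.map_apply]
    rw [← hfq y]
    congr 2
    funext i
    rw [AddCircle.coe_equivIco_mk_apply]; simp
  have hfc : Continuous f := by
    rw [hqq.isQuotientMap.continuous_iff]
    have : f ∘ q = fun y => (u y : ℂ) := funext hfu
    rw [this]; fun_prop
  have hcoef : ∀ k, UnitAddTorus.mFourierCoeff f k = fCoeff u k := by
    intro k
    rw [UnitAddTorus.mFourierCoeff_eq_integral f k 0]
    unfold fCoeff
    have hae : ({x : Pt d | ∀ i, x i ∈ Ioc ((0 : Pt d) i) ((0 : Pt d) i + 1)}) =ᵐ[volume]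
        torusBox d := by
      have h1 := (Measure.univ_pi_Ioc_ae_eq_Icc (μ := fun _ : Fin d => (volume : Measure ℝ))
        (f := fun _ => 0) (g := fun _ => 1))
      have h2 := (Measure.univ_pi_Ico_ae_eq_Icc (μ := fun _ : Fin d => (volume : Measure ℝ))
        (f := fun _ => 0) (g := fun _ => 1))
      have h3 := h1.trans h2.symm
      have e : ({x : Pt d | ∀ i, x i ∈ Ioc ((0 : Pt d) i) ((0 : Pt d) i + 1)})
        = (Set.univ.pi fun _ : Fin d => Set.Ioc (0:ℝ) 1) := by
        ext x; simp
      rw [e]; exact h3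
    rw [setIntegral_congr_set hae]
    refine integral_congr_ae (Filter.Eventually.of_forall fun y => ?_)
    have := hfu y
    simp only [hq] at this
    simp only [smul_eq_mul]
    rw [sc_mFourier, mul_comm]
    congr 1
  let F : C(UnitAddTorus (Fin d), ℂ) := ⟨f, hfc⟩
  have hS : Summable (UnitAddTorus.mFourierCoeff F) := by
    have : UnitAddTorus.mFourierCoeff F = fCoeff u := funext hcoef
    rw [this]; exact hs
  have := UnitAddTorus.hasSum_mFourier_series_apply_of_summable hS (q x)
  have e1 : F (q x) = u x := hfu x
  rw [e1] at this
  convert this using 2 with k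
  rw [smul_eq_mul]
  have e2 : UnitAddTorus.mFourierCoeff F k = fCoeff u k := hcoef k
  rw [e2]
  congr 1
  exact (sc_mFourier k x).symm

/-- Gaussian characteristic function. -/
theorem sc_gauss {d : ℕ} (k : Fin d → ℤ) (v : NNReal) :
    ∫ y, fChar k y ∂(Measure.pi fun _ : Fin d => ProbabilityTheory.gaussianReal 0 v)
      = ((Real.exp (-(v * (2 * π ^ 2 * normZ k ^ 2))) : ℝ) : ℂ) := by
  have h1 : ∀ y : Pt d, fChar k y =
      ∏ i, Complex.exp (((2 * π * k i : ℝ) : ℂ) * (y i : ℂ) * Complex.I) := by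
    intro y
    rw [← Complex.exp_sum]
    unfold fChar
    congr 1
    push_cast
    rw [Finset.mul_sum]
    refine Finset.sum_congr rfl fun i _ => ?_
    ring
  simp_rw [h1]
  rw [integral_fintype_prod_eq_prod
    (f := fun i (y : ℝ) => Complex.exp (((2 * π * k i : ℝ) : ℂ) * (y : ℂ) * Complex.I))]
  simp_rw [← charFun_apply_real, ProbabilityTheory.charFun_gaussianReal]
  rw [← Complex.exp_sum, Complex.ofReal_exp]
  congr 1
  unfold normZ
  rw [Real.sq_sqrt (Finset.sum_nonneg fun i _ => sq_nonneg _)]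
  push_cast
  rw [Finset.mul_sum, Finset.mul_sum, ← Finset.sum_neg_distrib]
  refine Finset.sum_congr rfl fun i _ => ?_
  ring

/-- The heat semigroup does not exceed the maximum. -/
theorem sc_heat {d : ℕ} (c : (Fin d → ℤ) → ℂ) (hc : Summable c) (x0 : Pt d)
    (hmax : ∀ x, (∑' k, c k * fChar k x).re ≤ (∑' k, c k * fChar k x0).re) (v : NNReal) :
    0 ≤ ∑' k, (c k * fChar k x0).re * (1 - Real.exp (-(v * (2 * π ^ 2 * normZ k ^ 2)))) := by
  set μ := (Measure.pi fun _ : Fin d => ProbabilityTheory.gaussianReal 0 v)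
  have hcn : Summable fun k => ‖c k‖ := hc.norm
  have hsx : ∀ x, Summable fun k => c k * fChar k x := by
    intro x
    refine Summable.of_norm ?_
    simpa [sc_fChar_norm] using hcn
  have hInt0 : ∀ k, Integrable (fun y => c k * fChar k (x0 + y)) μ := by
    intro k
    refine Integrable.of_bound (C := ‖c k‖) ?_ ?_
    · exact (Continuous.aestronglyMeasurable
        (continuous_const.mul ((sc_fChar_cont k).comp (continuous_const.add continuous_id))))
    · refine Filter.Eventually.of_forall fun y => ?_
      simp [sc_fChar_norm]
  have hsn : Summable fun k => ∫ y, ‖c k * fChar k (x0 + y)‖ ∂μ := by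
    simp only [norm_mul, sc_fChar_norm, mul_one, integral_const, probReal_univ, one_smul]
    exact hcn
  have hS := hasSum_integral_of_summable_integral_norm hInt0 hsn
  have hval : ∀ k, ∫ y, c k * fChar k (x0 + y) ∂μ
      = ((Real.exp (-(v * (2 * π ^ 2 * normZ k ^ 2))) : ℝ) : ℂ) * (c k * fChar k x0) := by
    intro k
    simp_rw [sc_fChar_add, ← mul_assoc]
    rw [integral_const_mul, sc_gauss]
    ring
  simp_rw [hval] at hS
  have hre := Complex.hasSum_re hS
  have hre0 := Complex.hasSum_re (hsx x0).hasSum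
  have hd := hre0.sub hre
  have hIntF : Integrable (fun y => ∑' k, c k * fChar k (x0 + y)) μ := by
    refine Integrable.of_bound (C := ∑' k, ‖c k‖) ?_ ?_
    · refine Continuous.aestronglyMeasurable ?_
      refine continuous_tsum (u := fun k => ‖c k‖) ?_ hcn ?_
      · intro k
        exact (continuous_const.mul ((sc_fChar_cont k).comp (continuous_const.add continuous_id)))
      · intro k y; simp [sc_fChar_norm]
    · refine Filter.Eventually.of_forall fun y => ?_
      refine (norm_tsum_le_tsum_norm ?_).trans ?_
      · simpa [sc_fChar_norm] using hcn
      · simp [sc_fChar_norm]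
  have hle : (∫ y, ∑' k, c k * fChar k (x0 + y) ∂μ).re ≤ (∑' k, c k * fChar k x0).re := by
    have e : (∫ y, ∑' k, c k * fChar k (x0 + y) ∂μ).re
        = ∫ y, (∑' k, c k * fChar k (x0 + y)).re ∂μ := by
      have := (integral_re hIntF)
      simpa using this.symm
    rw [e]
    calc _ ≤ ∫ y, (∑' k, c k * fChar k x0).re ∂μ := by
          refine integral_mono hIntF.re (integrable_const _) fun y => ?_
          exact hmax (x0 + y)
      _ = _ := by simp
  have := hd.tsum_eq
  have e2 : ∀ k, (c k * fChar k x0).re * (1 - Real.exp (-(v * (2 * π ^ 2 * normZ k ^ 2))))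
      = (c k * fChar k x0).re -
        (((Real.exp (-(v * (2 * π ^ 2 * normZ k ^ 2))) : ℝ) : ℂ) * (c k * fChar k x0)).re := by
    intro k
    rw [Complex.re_ofReal_mul]; ring
  simp_rw [e2]
  rw [this]
  linarith

theorem sc_levy_integrable {s : ℝ} (hs : s ∈ Set.Ioo (0:ℝ) 1) :
    IntegrableOn (fun t : ℝ => (1 - Real.exp (-t)) * t ^ (-1 - s)) (Ioi 0) := by
  have hmeas : AEStronglyMeasurable (fun t : ℝ => (1 - Real.exp (-t)) * t ^ (-1 - s))
      volume := by
    refine Measurable.aestronglyMeasurable ?_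
    fun_prop
  rw [← Ioc_union_Ioi_eq_Ioi (zero_le_one' ℝ)]
  refine IntegrableOn.union ?_ ?_
  · have h1 : IntegrableOn (fun t : ℝ => t ^ (-s)) (Ioc 0 1) := by
      have := intervalIntegral.intervalIntegrable_rpow' (a := 0) (b := 1) (r := -s)
        (by linarith [hs.2])
      rwa [intervalIntegrable_iff_integrableOn_Ioc_of_le zero_le_one] at this
    refine Integrable.mono' h1 hmeas.restrict ?_
    refine (ae_restrict_iff' measurableSet_Ioc).2 (Filter.Eventually.of_forall fun t ht => ?_)
    have h0 : 0 ≤ 1 - Real.exp (-t) := by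
      have := Real.exp_le_one_iff.2 (show -t ≤ 0 by linarith [ht.1]); linarith
    have h2 : 1 - Real.exp (-t) ≤ t := by
      have := Real.add_one_le_exp (-t); linarith
    have h3 : 0 ≤ t ^ (-1 - s) := Real.rpow_nonneg ht.1.le _
    rw [Real.norm_of_nonneg (mul_nonneg h0 h3)]
    calc _ ≤ t * t ^ (-1 - s) := by gcongr
      _ = t ^ (-s) := by
        rw [show -s = 1 + (-1 - s) by ring, Real.rpow_add ht.1, Real.rpow_one]
  · have h1 := integrableOn_Ioi_rpow_of_lt (a := -1 - s) (c := 1) (by linarith [hs.1]) one_pos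
    refine Integrable.mono' h1 hmeas.restrict ?_
    refine (ae_restrict_iff' measurableSet_Ioi).2 (Filter.Eventually.of_forall fun t ht => ?_)
    have ht' : 0 < t := lt_trans one_pos ht
    have h0 : 0 ≤ 1 - Real.exp (-t) := by
      have := Real.exp_le_one_iff.2 (show -t ≤ 0 by linarith); linarith
    have h2 : 1 - Real.exp (-t) ≤ 1 := by
      have := Real.exp_pos (-t); linarith
    have h3 : 0 ≤ t ^ (-1 - s) := Real.rpow_nonneg ht'.le _
    rw [Real.norm_of_nonneg (mul_nonneg h0 h3)]
    calc _ ≤ 1 * t ^ (-1 - s) := by gcongr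
      _ = _ := one_mul _

theorem sc_levy_pos {s : ℝ} (hs : s ∈ Set.Ioo (0:ℝ) 1) :
    0 < ∫ t in Ioi (0:ℝ), (1 - Real.exp (-t)) * t ^ (-1 - s) := by
  have hpos : ∀ t ∈ Ioi (0:ℝ), 0 < (1 - Real.exp (-t)) * t ^ (-1 - s) := by
    intro t ht
    have : Real.exp (-t) < 1 := by
      rw [Real.exp_lt_one_iff]; simpa using ht
    exact mul_pos (by linarith) (Real.rpow_pos_of_pos ht _)
  rw [setIntegral_pos_iff_support_of_nonneg_ae]
  · have : Ioi (0:ℝ) ⊆ Function.support (fun t : ℝ => (1 - Real.exp (-t)) * t ^ (-1 - s)) :=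
      fun t ht => (hpos t ht).ne'
    rw [inter_eq_right.2 this]
    simp
  · exact (ae_restrict_iff' measurableSet_Ioi).2
      (Filter.Eventually.of_forall fun t ht => (hpos t ht).le)
  · exact sc_levy_integrable hs

theorem sc_levy_scale {s : ℝ} (hs : s ∈ Set.Ioo (0:ℝ) 1) (l : ℝ) (hl : 0 ≤ l) :
    IntegrableOn (fun t : ℝ => (1 - Real.exp (-(t * l))) * t ^ (-1 - s)) (Ioi 0) ∧
    ∫ t in Ioi (0:ℝ), (1 - Real.exp (-(t * l))) * t ^ (-1 - s)
      = l ^ s * ∫ t in Ioi (0:ℝ), (1 - Real.exp (-t)) * t ^ (-1 - s) := by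
  rcases hl.eq_or_lt with rfl | hl
  · simp [Real.zero_rpow hs.1.ne']
  have key : ∀ t ∈ Ioi (0:ℝ), (1 - Real.exp (-(t * l))) * t ^ (-1 - s)
      = l ^ (1 + s) * ((1 - Real.exp (-(l * t))) * (l * t) ^ (-1 - s)) := by
    intro t ht
    have ht : 0 < t := ht
    rw [Real.mul_rpow hl.le ht.le, mul_comm t l]
    have : l ^ (1 + s) * l ^ (-1 - s) = 1 := by
      rw [← Real.rpow_add hl]; simp
    linear_combination (-(1 - Real.exp (-(l * t))) * t ^ (-1 - s)) * this
  constructor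
  · rw [integrableOn_congr_fun key measurableSet_Ioi]
    refine Integrable.const_mul ?_ _
    have := (integrableOn_Ioi_comp_mul_left_iff
      (fun t : ℝ => (1 - Real.exp (-t)) * t ^ (-1 - s)) 0 hl).2
    simp only [mul_zero] at this
    exact this (sc_levy_integrable hs)
  · rw [setIntegral_congr_fun measurableSet_Ioi key, integral_const_mul]
    rw [integral_comp_mul_left_Ioi (fun t : ℝ => (1 - Real.exp (-t)) * t ^ (-1 - s)) 0 hl]
    rw [mul_zero, smul_eq_mul, ← mul_assoc, Real.rpow_add hl, Real.rpow_one]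
    congr 1
    field_simp

/-- Maximum principle for the fractional Laplacian at the level of Fourier series. -/
theorem sc_series_max {d : ℕ} {s : ℝ} (hs : s ∈ Set.Ioo (0:ℝ) 1) (c : (Fin d → ℤ) → ℂ)
    (hc : Summable c) (hcs : Summable fun k => ‖c k‖ * normZ k ^ (2 * s)) (x0 : Pt d)
    (hmax : ∀ x, (∑' k, c k * fChar k x).re ≤ (∑' k, c k * fChar k x0).re) :
    0 ≤ ∑' k, (c k * fChar k x0).re * normZ k ^ (2 * s) := by
  set I := ∫ t in Ioi (0:ℝ), (1 - Real.exp (-t)) * t ^ (-1 - s)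
  have hI : 0 < I := sc_levy_pos hs
  have hl : ∀ k : Fin d → ℤ, 0 ≤ 2 * π ^ 2 * normZ k ^ 2 := fun k => by positivity
  have hn : ∀ k : Fin d → ℤ, 0 ≤ normZ k := fun k => Real.sqrt_nonneg _
  have hls : ∀ k : Fin d → ℤ, (2 * π ^ 2 * normZ k ^ 2) ^ s
      = (2 * π ^ 2) ^ s * normZ k ^ (2 * s) := by
    intro k
    rw [Real.mul_rpow (by positivity) (by positivity), Real.rpow_mul (hn k)]
    norm_num
  set c0 := (2 * π ^ 2) ^ s
  have hc0 : 0 < c0 := by positivity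
  set F : (Fin d → ℤ) → ℝ → ℝ := fun k t => (c k * fChar k x0).re *
    ((1 - Real.exp (-(t * (2 * π ^ 2 * normZ k ^ 2)))) * t ^ (-1 - s)) with hF
  have hInt0 : ∀ k, Integrable (F k) (volume.restrict (Ioi 0)) := fun k =>
    ((sc_levy_scale hs _ (hl k)).1).const_mul _
  have hval : ∀ k, ∫ t in Ioi (0:ℝ), F k t = (c k * fChar k x0).re * normZ k ^ (2 * s) * (c0 * I) := by
    intro k
    rw [integral_const_mul, (sc_levy_scale hs _ (hl k)).2, hls]; ring
  have hvaln : ∀ k, ∫ t in Ioi (0:ℝ), ‖F k t‖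
      = |(c k * fChar k x0).re| * normZ k ^ (2 * s) * (c0 * I) := by
    intro k
    have : ∀ t ∈ Ioi (0:ℝ), ‖F k t‖ = |(c k * fChar k x0).re| *
        ((1 - Real.exp (-(t * (2 * π ^ 2 * normZ k ^ 2)))) * t ^ (-1 - s)) := by
      intro t ht
      have ht : 0 < t := ht
      rw [hF]
      simp only
      rw [Real.norm_eq_abs, abs_mul]
      congr 1
      refine abs_of_nonneg (mul_nonneg ?_ (Real.rpow_nonneg ht.le _))
      have := Real.exp_le_one_iff.2 (show -(t * (2 * π ^ 2 * normZ k ^ 2)) ≤ 0 by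
        have := mul_nonneg ht.le (hl k); linarith)
      linarith
    rw [setIntegral_congr_fun measurableSet_Ioi this, integral_const_mul,
      (sc_levy_scale hs _ (hl k)).2, hls]; ring
  have hsn : Summable fun k => ∫ t in Ioi (0:ℝ), ‖F k t‖ := by
    simp_rw [hvaln]
    refine Summable.mul_right _ ?_
    refine Summable.of_nonneg_of_le (fun k => ?_) (fun k => ?_) hcs
    · exact mul_nonneg (abs_nonneg _) (Real.rpow_nonneg (hn k) _)
    · refine mul_le_mul_of_nonneg_right ?_ (Real.rpow_nonneg (hn k) _)
      refine (Complex.abs_re_le_norm _).trans ?_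
      simp [sc_fChar_norm]
  have hS := hasSum_integral_of_summable_integral_norm hInt0 hsn
  simp_rw [hval] at hS
  have hpos : 0 ≤ ∫ t in Ioi (0:ℝ), ∑' k, F k t := by
    refine setIntegral_nonneg measurableSet_Ioi fun t ht => ?_
    have ht : 0 < t := ht
    have := sc_heat c hc x0 hmax ⟨t, ht.le⟩
    have e : ∑' k, F k t = (∑' k, (c k * fChar k x0).re *
        (1 - Real.exp (-(t * (2 * π ^ 2 * normZ k ^ 2))))) * t ^ (-1 - s) := by
      rw [← tsum_mul_right]
      refine tsum_congr fun k => ?_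
      rw [hF]; ring
    rw [e]
    exact mul_nonneg this (Real.rpow_nonneg ht.le _)
  have e := hS.tsum_eq
  rw [tsum_mul_right] at e
  have h3 : 0 < c0 * I := mul_pos hc0 hI
  rw [← e] at hpos
  exact nonneg_of_mul_nonneg_left hpos h3

theorem sc_normZ_one {d : ℕ} (k : Fin d → ℤ) (hk : k ≠ 0) : 1 ≤ normZ k := by
  unfold normZ
  obtain ⟨i, hi⟩ := Function.ne_iff.1 hk
  rw [Real.one_le_sqrt]
  have h1 : (1:ℝ) ≤ (k i : ℝ) ^ 2 := by
    have : (1:ℤ) ≤ k i ^ 2 := by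
      have : 0 < k i ^ 2 := by
        have : k i ≠ 0 := hi
        positivity
      omega
    exact_mod_cast this
  exact h1.trans (Finset.single_le_sum (f := fun i => (k i : ℝ) ^ 2) (fun i _ => sq_nonneg _) (Finset.mem_univ i))

/-- Three-point maximum principle for the fractional Laplacian. -/
theorem sc_frac_max {d : ℕ} {s : ℝ} (hs : s ∈ Set.Ioo (0:ℝ) 1) (u : Pt d → ℝ)
    (hu : Continuous u) (hp : IsPeriodicF u) (a b e : ℝ) (h x0 : Pt d)
    (hmax : ∀ x, a * u (x + h) + b * u (x - h) + e * u x
      ≤ a * u (x0 + h) + b * u (x0 - h) + e * u x0) :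
    0 ≤ a * fracLap s u (x0 + h) + b * fracLap s u (x0 - h) + e * fracLap s u x0 := by
  by_cases hS : Summable fun k => ‖fCoeff u k‖ * normZ k ^ (2 * s)
  swap
  · have hz : ∀ x, fracLap s u x = 0 := by
      intro x
      unfold fracLap
      rw [tsum_eq_zero_of_not_summable, mul_zero, Complex.zero_re]
      intro h
      apply hS
      have := h.norm
      refine this.congr fun k => ?_
      rw [norm_mul, norm_mul, sc_fChar_norm, Complex.norm_real, Real.norm_of_nonneg
        (Real.rpow_nonneg (show 0 ≤ normZ k from Real.sqrt_nonneg _) _)]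
      ring
    simp [hz]
  have hn : ∀ k : Fin d → ℤ, 0 ≤ normZ k := fun k => Real.sqrt_nonneg _
  have hC : Summable (fCoeff u) := by
    refine Summable.of_norm ?_
    refine Summable.of_norm_bounded_eventually hS ?_
    have : ({0}ᶜ : Set (Fin d → ℤ)) ∈ Filter.cofinite := by
      rw [Filter.mem_cofinite, compl_compl]; exact Set.finite_singleton 0
    filter_upwards [this] with k hk
    rw [norm_norm]
    have h1 : 1 ≤ normZ k ^ (2 * s) :=
      Real.one_le_rpow (sc_normZ_one k hk) (by linarith [hs.1])
    exact le_mul_of_one_le_right (norm_nonneg _) h1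
  have hinv := sc_inversion u hu hp hC
  have hFs : ∀ x, HasSum (fun k => (fCoeff u k * fChar k x).re * normZ k ^ (2 * s))
      ((((2*π) ^ (2*s) : ℝ))⁻¹ * fracLap s u x) := by
    intro x
    have hsum : Summable fun k => ((normZ k ^ (2*s) : ℝ) : ℂ) * fCoeff u k * fChar k x := by
      refine Summable.of_norm (hS.congr fun k => ?_)
      rw [norm_mul, norm_mul, sc_fChar_norm, Complex.norm_real, Real.norm_of_nonneg
        (Real.rpow_nonneg (show 0 ≤ normZ k from Real.sqrt_nonneg _) _)]
      ring
    have := Complex.hasSum_re hsum.hasSum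
    unfold fracLap
    rw [Complex.re_ofReal_mul, inv_mul_cancel_left₀ (by positivity)]
    refine this.congr_fun fun k => ?_
    rw [mul_assoc, Complex.re_ofReal_mul, mul_comm]
  set c : (Fin d → ℤ) → ℂ := fun k => fCoeff u k * (a * fChar k h + b * fChar k (-h) + e) with hc
  have hcb : ∀ k, ‖c k‖ ≤ (|a| + |b| + |e|) * ‖fCoeff u k‖ := by
    intro k
    rw [hc]
    simp only
    rw [norm_mul, mul_comm]
    refine mul_le_mul_of_nonneg_right ?_ (norm_nonneg _)
    refine (norm_add_le _ _).trans (add_le_add ((norm_add_le _ _).trans ?_) ?_)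
    · simp [sc_fChar_norm]
    · simp
  have hcS : Summable c := Summable.of_norm_bounded (hC.norm.mul_left _) hcb
  have hcs : Summable fun k => ‖c k‖ * normZ k ^ (2 * s) := by
    refine Summable.of_nonneg_of_le (fun k => ?_) (fun k => ?_) (hS.mul_left (|a| + |b| + |e|))
    · exact mul_nonneg (norm_nonneg _) (Real.rpow_nonneg (hn k) _)
    · rw [← mul_assoc]
      exact mul_le_mul_of_nonneg_right (hcb k) (Real.rpow_nonneg (hn k) _)
  have hcx : ∀ k x, c k * fChar k x = a * (fCoeff u k * fChar k (x + h))
      + b * (fCoeff u k * fChar k (x - h)) + e * (fCoeff u k * fChar k x) := by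
    intro k x
    rw [hc, sub_eq_add_neg, sc_fChar_add, sc_fChar_add]; ring
  have hg : ∀ x, (∑' k, c k * fChar k x).re = a * u (x + h) + b * u (x - h) + e * u x := by
    intro x
    have h1 := (((hinv (x + h)).mul_left (a:ℂ)).add ((hinv (x - h)).mul_left (b:ℂ))).add
      ((hinv x).mul_left (e:ℂ))
    simp_rw [hcx]
    rw [h1.tsum_eq]
    simp
  have key := sc_series_max hs c hcS hcs x0 (fun x => by rw [hg, hg]; exact hmax x)
  have h1 := (((hFs (x0 + h)).mul_left a).add ((hFs (x0 - h)).mul_left b)).add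
      ((hFs x0).mul_left e)
  have e1 : (∑' k, (c k * fChar k x0).re * normZ k ^ (2 * s)) = ∑' k,
      (a * ((fCoeff u k * fChar k (x0 + h)).re * normZ k ^ (2 * s))
       + b * ((fCoeff u k * fChar k (x0 - h)).re * normZ k ^ (2 * s))
       + e * ((fCoeff u k * fChar k x0).re * normZ k ^ (2 * s))) := by
    refine tsum_congr fun k => ?_
    rw [hcx, Complex.add_re, Complex.add_re, Complex.re_ofReal_mul, Complex.re_ofReal_mul,
      Complex.re_ofReal_mul]
    ring
  rw [e1, h1.tsum_eq] at key
  have hp : 0 < ((2*π) ^ (2*s) : ℝ)⁻¹ := by positivity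
  have : 0 ≤ ((2*π) ^ (2*s) : ℝ)⁻¹ *
    (a * fracLap s u (x0 + h) + b * fracLap s u (x0 - h) + e * fracLap s u x0) := by
    linarith
  exact nonneg_of_mul_nonneg_right this hp

section calcs
variable {E : Type*} [NormedAddCommGroup E] [NormedSpace ℝ E]

theorem sc_line1 (f : E → ℝ) (hf : Differentiable ℝ f) (x h : E) (τ : ℝ) :
    HasDerivAt (fun t : ℝ => f (x + t • h)) (fderiv ℝ f (x + τ • h) h) τ := by
  have h1 : HasDerivAt (fun t : ℝ => x + t • h) h τ := by
    simpa using ((hasDerivAt_id τ).smul_const h).const_add x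
  exact ((hf (x + τ • h)).hasFDerivAt.comp_hasDerivAt τ h1)

theorem sc_line2 (f : E → ℝ) (hf : ContDiff ℝ 2 f) (x h k : E) (τ : ℝ) :
    HasDerivAt (fun t : ℝ => fderiv ℝ f (x + t • h) k)
      (fderiv ℝ (fderiv ℝ f) (x + τ • h) h k) τ := by
  have h1 : HasDerivAt (fun t : ℝ => x + t • h) h τ := by
    simpa using ((hasDerivAt_id τ).smul_const h).const_add x
  have hd : Differentiable ℝ (fderiv ℝ f) :=
    (hf.fderiv_right (m := 1) (by norm_num)).differentiable (by norm_num)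
  have h2 := ((hd (x + τ • h)).hasFDerivAt.comp_hasDerivAt τ h1)
  have h3 := h2.clm_apply (hasDerivAt_const τ k)
  simpa using h3

theorem sc_second_1d (φ φ' : ℝ → ℝ) (c : ℝ) (h1 : ∀ τ, HasDerivAt φ (φ' τ) τ)
    (h2 : HasDerivAt φ' c 0) (hmax : ∀ τ, φ τ ≤ φ 0) : c ≤ 0 := by
  by_contra hc
  push Not at hc
  have e : deriv φ = φ' := funext fun τ => (h1 τ).deriv
  have hl : IsLocalMax φ 0 := Filter.Eventually.of_forall hmax
  have h0 : deriv φ 0 = 0 := hl.deriv_eq_zero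
  have hm : IsLocalMin φ 0 := isLocalMin_of_deriv_deriv_pos
    (by rw [e, h2.deriv]; exact hc) h0 (h1 0).continuousAt
  have heq : φ =ᶠ[𝓝 0] fun _ => φ 0 := by
    filter_upwards [hm] with τ hτ using le_antisymm (hmax τ) hτ
  have e2 : deriv φ =ᶠ[𝓝 0] fun _ => 0 := by
    have := heq.deriv
    simpa using this
  rw [e] at e2
  have := e2.deriv_eq
  rw [h2.deriv] at this
  simp at this
  linarith

theorem sc_second_diff (φ φ' φ'' : ℝ → ℝ) (m : ℝ) (h1 : ∀ τ, HasDerivAt φ (φ' τ) τ)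
    (h2 : ∀ τ, HasDerivAt φ' (φ'' τ) τ) (hm : ∀ τ ∈ Icc (-1:ℝ) 1, -m ≤ φ'' τ) :
    -m ≤ φ 1 + φ (-1) - 2 * φ 0 := by
  have hc : ConvexOn ℝ (Icc (-1:ℝ) 1) (fun τ => φ τ + m / 2 * τ ^ 2) := by
    have d1 : ∀ τ, HasDerivAt (fun τ => φ τ + m / 2 * τ ^ 2) (φ' τ + m * τ) τ := by
      intro τ
      have := (h1 τ).add (((hasDerivAt_id τ).pow 2).const_mul (m / 2))
      refine this.congr_deriv ?_
      simp; ring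
    have d2 : ∀ τ, HasDerivAt (fun τ => φ' τ + m * τ) (φ'' τ + m) τ := by
      intro τ
      have := (h2 τ).add ((hasDerivAt_id τ).const_mul m)
      refine this.congr_deriv ?_
      simp
    refine convexOn_of_hasDerivWithinAt2_nonneg (convex_Icc _ _)
      (fun τ _ => (d1 τ).continuousAt.continuousWithinAt)
      (fun τ _ => (d1 τ).hasDerivWithinAt) (fun τ _ => (d2 τ).hasDerivWithinAt) ?_
    intro τ hτ
    have := hm τ (interior_subset hτ)
    linarith
  have := hc.2 (show (1:ℝ) ∈ Icc (-1:ℝ) 1 by norm_num) (show (-1:ℝ) ∈ Icc (-1:ℝ) 1 by norm_num)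
    (show (0:ℝ) ≤ 1/2 by norm_num) (show (0:ℝ) ≤ 1/2 by norm_num) (by norm_num)
  norm_num at this
  linarith

theorem sc_convex_1d (φ φ' φ'' : ℝ → ℝ) (h1 : ∀ τ, HasDerivAt φ (φ' τ) τ)
    (h2 : ∀ τ, HasDerivAt φ' (φ'' τ) τ) (hm : ∀ τ, 0 ≤ φ'' τ) (r : ℝ) (hr : 0 ≤ r) :
    φ 0 + r * φ' 0 ≤ φ r := by
  have hc : ConvexOn ℝ univ φ := by
    refine convexOn_of_hasDerivWithinAt2_nonneg convex_univ
      (fun τ _ => (h1 τ).continuousAt.continuousWithinAt)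
      (fun τ _ => (h1 τ).hasDerivWithinAt) (fun τ _ => (h2 τ).hasDerivWithinAt) ?_
    intro τ _
    exact hm τ
  rcases hr.eq_or_lt with rfl | hr
  · simp
  have := hc.le_slope_of_hasDerivAt (mem_univ 0) (mem_univ r) hr (h1 0)
  rw [slope_def_field, le_div_iff₀ (by linarith)] at this
  linarith

end calcs

theorem sc_dot_grad {d : ℕ} (f : Pt d → ℝ) (x q : Pt d) :
    dotP (grad f x) q = fderiv ℝ f x q := by
  unfold dotP grad
  conv_rhs => rw [pi_eq_sum_univ' q]
  rw [map_sum]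
  refine Finset.sum_congr rfl fun i _ => ?_
  rw [map_smul, smul_eq_mul, mul_comm]

theorem sc_norm_le_vnorm {d : ℕ} (x : Pt d) : ‖x‖ ≤ vnorm x := by
  unfold vnorm
  rw [pi_norm_le_iff_of_nonneg (Real.sqrt_nonneg _)]
  intro i
  rw [Real.norm_eq_abs, ← Real.sqrt_sq_eq_abs]
  exact Real.sqrt_le_sqrt (Finset.single_le_sum (f := fun i => x i ^ 2) (fun i _ => sq_nonneg _) (Finset.mem_univ i))

theorem sc_vnorm_eq {d : ℕ} (x : Pt d) : vnorm x = ‖(WithLp.toLp 2 x : EuclideanSpace ℝ (Fin d))‖ := by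
  rw [EuclideanSpace.norm_eq]; simp [vnorm]

theorem sc_vnorm_add {d : ℕ} (x y : Pt d) : vnorm (x + y) ≤ vnorm x + vnorm y := by
  simp only [sc_vnorm_eq, WithLp.toLp_add]; exact norm_add_le _ _

theorem sc_vnorm_smul {d : ℕ} (c : ℝ) (x : Pt d) : vnorm (c • x) = |c| * vnorm x := by
  simp only [sc_vnorm_eq, WithLp.toLp_smul, norm_smul, Real.norm_eq_abs]

theorem sc_vnorm_nonneg {d : ℕ} (x : Pt d) : 0 ≤ vnorm x := Real.sqrt_nonneg _

theorem sc_vnorm_sq {d : ℕ} (x : Pt d) : vnorm x ^ 2 = ∑ i, x i ^ 2 :=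
  Real.sq_sqrt (Finset.sum_nonneg fun i _ => sq_nonneg _)

theorem sc_vnorm_pos {d : ℕ} (x : Pt d) (hx : x ≠ 0) : 0 < vnorm x := by
  rw [sc_vnorm_eq]; simpa using hx

theorem sc_iter2 {d : ℕ} (f : Pt d → ℝ) (x ξ : Pt d) :
    iteratedFDeriv ℝ 2 f x (fun _ => ξ) = fderiv ℝ (fderiv ℝ f) x ξ ξ := by
  rw [iteratedFDeriv_two_apply]

theorem sc_iter2_le {d : ℕ} (f : Pt d → ℝ) (x ξ : Pt d) (K : ℝ)
    (hK : ‖iteratedFDeriv ℝ 2 f x‖ ≤ K) :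
    |fderiv ℝ (fderiv ℝ f) x ξ ξ| ≤ K * vnorm ξ ^ 2 := by
  rw [← sc_iter2, ← Real.norm_eq_abs]
  refine ((iteratedFDeriv ℝ 2 f x).le_opNorm _).trans ?_
  simp only [Finset.prod_const, Finset.card_univ, Fintype.card_fin]
  gcongr
  · exact (norm_nonneg _).trans hK
  · exact sc_norm_le_vnorm ξ

/-- A function with bounded Hessian has bounded second differences. -/
theorem sc_diff2_le {d : ℕ} (f : Pt d → ℝ) (hf : ContDiff ℝ 2 f) (K : ℝ)
    (hK : ∀ x, ‖iteratedFDeriv ℝ 2 f x‖ ≤ K) (x h : Pt d) :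
    f (x + h) + f (x - h) - 2 * f x ≤ K * vnorm h ^ 2 := by
  have h1 := fun τ => (sc_line1 f (hf.differentiable (by norm_num)) x h τ).neg
  have h2 := fun τ => (sc_line2 f hf x h h τ).neg
  have := sc_second_diff _ _ _ (K * vnorm h ^ 2) h1 h2 (fun τ _ => by
    have := sc_iter2_le f (x + τ • h) h K (hK _)
    have := (abs_le.1 this).2
    linarith)
  simp only [Pi.neg_apply, one_smul, zero_smul, add_zero, neg_smul, ← sub_eq_add_neg] at this
  linarith

theorem sc_scalar {CH γ r R B η : ℝ} (hCH : 0 < CH) (hγ : 1 < γ) (hr : 0 ≤ r) (hR : 0 ≤ R)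
    (hB : 0 ≤ B) (hη : η ≤ 1/5) (hrR : r ≤ R + B * η) :
    -(2 * CH * (2 ^ γ * R ^ γ)) ≤
      CH * r ^ (γ - 2) * B ^ 2 - 2 * (CH * r ^ (γ - 1)) * B - CH * r ^ γ := by
  have hpos : 0 ≤ 2 * CH * (2 ^ γ * R ^ γ) := by positivity
  rcases hr.eq_or_lt with rfl | hr
  · rw [Real.zero_rpow (show γ - 1 ≠ 0 by linarith), Real.zero_rpow (show γ ≠ 0 by linarith)]
    have : 0 ≤ CH * (0:ℝ) ^ (γ - 2) * B ^ 2 := by positivity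
    linarith
  have e1 : r ^ (γ - 1) = r ^ (γ - 2) * r := by
    rw [show γ - 1 = (γ - 2) + 1 by ring, Real.rpow_add hr, Real.rpow_one]
  have e2 : r ^ γ = r ^ (γ - 2) * r ^ 2 := by
    conv_lhs => rw [show γ = (γ - 2) + 2 by ring]
    rw [Real.rpow_add hr]; norm_num
  have hw : 0 < r ^ (γ - 2) := Real.rpow_pos_of_pos hr _
  by_cases hc : B * η ≤ R
  · have h2 : r ^ γ ≤ 2 ^ γ * R ^ γ := by
      rw [← Real.mul_rpow (by norm_num) hR]
      exact Real.rpow_le_rpow hr.le (by linarith) (by linarith)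
    have h3 : CH * r ^ (γ - 2) * B ^ 2 - 2 * (CH * r ^ (γ - 1)) * B - CH * r ^ γ
        = CH * r ^ (γ - 2) * (B - r) ^ 2 - 2 * CH * r ^ γ := by
      rw [e1, e2]; ring
    rw [h3]
    have h4 : 0 ≤ CH * r ^ (γ - 2) * (B - r) ^ 2 := by positivity
    have h5 : 2 * CH * r ^ γ ≤ 2 * CH * (2 ^ γ * R ^ γ) := by gcongr
    linarith
  · push Not at hc
    have hr2 : r ≤ 2 / 5 * B := by nlinarith
    have h3 : CH * r ^ (γ - 2) * B ^ 2 - 2 * (CH * r ^ (γ - 1)) * B - CH * r ^ γ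
        = CH * r ^ (γ - 2) * (B ^ 2 - 2 * r * B - r ^ 2) := by
      rw [e1, e2]; ring
    rw [h3]
    have : 0 ≤ B ^ 2 - 2 * r * B - r ^ 2 := by nlinarith
    have : 0 ≤ CH * r ^ (γ - 2) * (B ^ 2 - 2 * r * B - r ^ 2) := by positivity
    linarith

section ham
variable {d : ℕ} {H : Pt d → Pt d → ℝ} {γ cH CH CtH : ℝ}

theorem sc_H_p_smooth (hH : HamHypCore d H γ cH CH CtH) (x : Pt d) : ContDiff ℝ 2 (H x) := by
  have := (hH.smooth.of_le (show (2 : WithTop ℕ∞) ≤ 3 by norm_num)).comp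
    (contDiff_prodMk_right x)
  exact this

theorem sc_H_x_smooth (hH : HamHypCore d H γ cH CH CtH) (p : Pt d) :
    ContDiff ℝ 2 (fun y => H y p) := by
  have := (hH.smooth.of_le (show (2 : WithTop ℕ∞) ≤ 3 by norm_num)).comp
    (contDiff_prodMk_left p)
  exact this

theorem sc_Hpp (hH : HamHypCore d H γ cH CH CtH) (x p ξ : Pt d) :
    CH * vnorm p ^ (γ-2) * vnorm ξ ^ 2 ≤ fderiv ℝ (fderiv ℝ (H x)) p ξ ξ := by
  by_contra hc
  push Not at hc
  set a := CH * vnorm p ^ (γ-2) * vnorm ξ ^ 2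
  set b := fderiv ℝ (fderiv ℝ (H x)) p ξ ξ
  have key : ∀ l : ℝ, l ^ 2 * (a - b) ≤ CtH := by
    intro l
    have := hH.h5 x p (l • ξ)
    rw [sc_iter2, sc_vnorm_smul] at this
    simp only [map_smul, smul_apply, smul_eq_mul, mul_pow, sq_abs] at this
    have e : l ^ 2 * (a - b) = CH * vnorm p ^ (γ - 2) * (l ^ 2 * vnorm ξ ^ 2) - l * (l * b) := by
      simp only [a]; ring
    rw [e]; simp only [b]; linarith
  have hd : 0 < a - b := by linarith
  have := key (Real.sqrt ((CtH + 1) / (a - b)))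
  rw [Real.sq_sqrt (div_nonneg (by linarith [hH.CtH_pos]) hd.le), div_mul_cancel₀ _ hd.ne'] at this
  linarith

theorem sc_D2 (hH : HamHypCore d H γ cH CH CtH) (x p h k : Pt d) :
    fderiv ℝ (fderiv ℝ fun q : Pt d × Pt d => H q.1 q.2) (x, p) (h, k) (h, k)
      = fderiv ℝ (fderiv ℝ (fun y => H y p)) x h h
        + 2 * fderiv ℝ (fun y => fderiv ℝ (H y) p) x h k
        + fderiv ℝ (fderiv ℝ (H x)) p k k := by
  set HH := fun q : Pt d × Pt d => H q.1 q.2 with hHH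
  have hs : ContDiff ℝ 2 HH := hH.smooth.of_le (by norm_num)
  have hd : Differentiable ℝ HH := hs.differentiable (by norm_num)
  have hdd : Differentiable ℝ (fderiv ℝ HH) :=
    (hs.fderiv_right (m := 1) (by norm_num)).differentiable (by norm_num)
  have hsym : IsSymmSndFDerivAt ℝ HH (x, p) :=
    hs.contDiffAt.isSymmSndFDerivAt (by simp)
  have hx1 : ∀ y q, fderiv ℝ (H y) q = (fderiv ℝ HH (y, q)).comp (ContinuousLinearMap.inr ℝ _ _) := by
    intro y q
    exact ((hd (y, q)).hasFDerivAt.comp q (hasFDerivAt_prodMk_right y q)).fderiv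
  have hx2 : ∀ y q, fderiv ℝ (fun y => H y q) y
      = (fderiv ℝ HH (y, q)).comp (ContinuousLinearMap.inl ℝ _ _) := by
    intro y q
    have hl : HasFDerivAt (fun e : Pt d => (e, q)) (ContinuousLinearMap.inl ℝ (Pt d) (Pt d)) y :=
      hasFDerivAt_prodMk_left y q
    exact (HasFDerivAt.comp (g := HH) y (hd (y, q)).hasFDerivAt hl).fderiv
  have hap : ∀ v : Pt d × Pt d, HasFDerivAt (fun z => fderiv ℝ HH z v)
      ((fderiv ℝ (fderiv ℝ HH) (x, p)).flip v) (x, p) := by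
    intro v
    have := (hdd (x, p)).hasFDerivAt.clm_apply (hasFDerivAt_const v (x, p))
    refine this.congr_fderiv ?_
    ext w <;> simp
  -- xx
  have e1 : fderiv ℝ (fderiv ℝ (fun y => H y p)) x h h
      = fderiv ℝ (fderiv ℝ HH) (x, p) (h, 0) (h, 0) := by
    have hdx : Differentiable ℝ (fderiv ℝ (fun y => H y p)) :=
      ((sc_H_x_smooth hH p).fderiv_right (m := 1) (by norm_num)).differentiable (by norm_num)
    have a1 : HasFDerivAt (fun y => fderiv ℝ (fun y => H y p) y h)
      ((fderiv ℝ (fderiv ℝ (fun y => H y p)) x).flip h) x := by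
      have := (hdx x).hasFDerivAt.clm_apply (hasFDerivAt_const h x)
      refine this.congr_fderiv ?_
      ext w; simp
    have hl : HasFDerivAt (fun e : Pt d => (e, p)) (ContinuousLinearMap.inl ℝ (Pt d) (Pt d)) x :=
      hasFDerivAt_prodMk_left x p
    have a2 := HasFDerivAt.comp (g := fun z => fderiv ℝ HH z (h, 0)) x (hap (h, 0)) hl
    have a3 : (fun y => fderiv ℝ (fun y => H y p) y h)
        = (fun z => fderiv ℝ HH z (h, 0)) ∘ (fun y => (y, p)) := by
      funext y; rw [hx2]; simp
    rw [a3] at a1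
    have := DFunLike.congr_fun (a1.unique a2) h
    simpa using this
  have e2 : fderiv ℝ (fun y => fderiv ℝ (H y) p) x h k
      = fderiv ℝ (fderiv ℝ HH) (x, p) (h, 0) (0, k) := by
    have hdx : DifferentiableAt ℝ (fun y => fderiv ℝ (H y) p) x := by
      have a3 : (fun y => fderiv ℝ (H y) p)
        = fun y => (fderiv ℝ HH (y, p)).comp (ContinuousLinearMap.inr ℝ _ _) := by
        funext y; rw [hx1]
      rw [a3]
      have : DifferentiableAt ℝ (fun y => fderiv ℝ HH (y, p)) x :=
        (hdd (x, p)).comp x (hasFDerivAt_prodMk_left x p).differentiableAt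
      exact this.clm_comp (differentiableAt_const _)
    have a1 : HasFDerivAt (fun y => fderiv ℝ (H y) p k)
      ((fderiv ℝ (fun y => fderiv ℝ (H y) p) x).flip k) x := by
      have := hdx.hasFDerivAt.clm_apply (hasFDerivAt_const k x)
      refine this.congr_fderiv ?_
      ext w; simp
    have hl : HasFDerivAt (fun e : Pt d => (e, p)) (ContinuousLinearMap.inl ℝ (Pt d) (Pt d)) x :=
      hasFDerivAt_prodMk_left x p
    have a2 := HasFDerivAt.comp (g := fun z => fderiv ℝ HH z (0, k)) x (hap (0, k)) hl
    have a3 : (fun y => fderiv ℝ (H y) p k)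
        = (fun z => fderiv ℝ HH z (0, k)) ∘ (fun y => (y, p)) := by
      funext y; rw [hx1]; simp
    rw [a3] at a1
    have := DFunLike.congr_fun (a1.unique a2) h
    simpa using this
  have e3 : fderiv ℝ (fderiv ℝ (H x)) p k k
      = fderiv ℝ (fderiv ℝ HH) (x, p) (0, k) (0, k) := by
    have hdx : Differentiable ℝ (fderiv ℝ (H x)) :=
      ((sc_H_p_smooth hH x).fderiv_right (m := 1) (by norm_num)).differentiable (by norm_num)
    have a1 : HasFDerivAt (fun q => fderiv ℝ (H x) q k)
      ((fderiv ℝ (fderiv ℝ (H x)) p).flip k) p := by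
      have := (hdx p).hasFDerivAt.clm_apply (hasFDerivAt_const k p)
      refine this.congr_fderiv ?_
      ext w; simp
    have a2 := (hap (0, k)).comp p (hasFDerivAt_prodMk_right x p)
    have a3 : (fun q => fderiv ℝ (H x) q k)
        = (fun z => fderiv ℝ HH z (0, k)) ∘ (fun q => (x, q)) := by
      funext y; rw [hx1]; simp
    rw [a3] at a1
    have := DFunLike.congr_fun (a1.unique a2) k
    simpa using this
  have e4 : ((h, k) : Pt d × Pt d) = (h, 0) + (0, k) := by simp
  rw [e1, e2, e3, e4]
  simp only [map_add, add_apply]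
  have := hsym (0, k) (h, 0)
  rw [this]; ring

/-- The key lower bound for the second difference of the Hamiltonian. -/
theorem sc_ham (hH : HamHypCore d H γ cH CH CtH) (x h p : Pt d) (B κ : ℝ) (hB : 0 ≤ B)
    (hκ : κ = 2 * 3 ^ γ * vnorm h ^ 2) (hκ1 : κ ≤ 1) (hh : vnorm h ≤ 1/5) :
    -(vnorm h ^ 2 * (2 * CtH * B + CtH + 2 * 3 ^ γ * cH)) ≤
      H (x + h) ((1 + κ/2) • p + B • h) + H (x - h) ((1 + κ/2) • p - B • h)
        - (2 + κ) * H x p := by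
  set P := (1 + κ/2) • p with hP
  have hγ := hH.gamma_gt_one
  have hCH := hH.CH_pos
  have hn := sc_vnorm_nonneg h
  have hκ0 : 0 ≤ κ := by rw [hκ]; positivity
  set HH := fun q : Pt d × Pt d => H q.1 q.2 with hHH
  have hs : ContDiff ℝ 2 HH := hH.smooth.of_le (by norm_num)
  set m := vnorm h ^ 2 * (2 * CH * (2 ^ γ * vnorm P ^ γ) + 2 * CtH * B + CtH) with hm
  have h1 := sc_second_diff _ _ _ m (sc_line1 HH (hs.differentiable (by norm_num)) (x, P) (h, B • h))
    (sc_line2 HH hs (x, P) (h, B • h) (h, B • h)) (by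
      intro τ hτ
      have e : ((x, P) : Pt d × Pt d) + τ • (h, B • h) = (x + τ • h, P + (τ * B) • h) := by
        simp [smul_smul]
      rw [e, sc_D2 hH]
      set y := x + τ • h
      set q := P + (τ * B) • h
      have hr : vnorm q ≤ vnorm P + B * vnorm h := by
        refine (sc_vnorm_add _ _).trans ?_
        rw [sc_vnorm_smul (τ * B), abs_mul, abs_of_nonneg hB]
        have : |τ| ≤ 1 := abs_le.2 hτ
        have h3 : |τ| * B * vnorm h ≤ 1 * B * vnorm h := by gcongr
        linarith
      have t1 : -((CH * vnorm q ^ γ + CtH) * vnorm h ^ 2)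
          ≤ fderiv ℝ (fderiv ℝ (fun y => H y q)) y h h :=
        (abs_le.1 (sc_iter2_le _ y h _ (hH.h3 y q))).1
      have t2 : -((CH * vnorm q ^ (γ-1) + CtH) * vnorm h * (B * vnorm h))
          ≤ fderiv ℝ (fun y => fderiv ℝ (H y) q) y h (B • h) := by
        have a := ContinuousLinearMap.le_opNorm₂ (fderiv ℝ (fun y => fderiv ℝ (H y) q) y) h (B • h)
        have b : ‖fderiv ℝ (fun y => fderiv ℝ (H y) q) y‖ * ‖h‖ * ‖B • h‖
            ≤ (CH * vnorm q ^ (γ-1) + CtH) * vnorm h * (B * vnorm h) := by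
          have b1 := hH.h4 y q
          have b2 := sc_norm_le_vnorm h
          have b3 : ‖B • h‖ ≤ B * vnorm h := by
            rw [norm_smul, Real.norm_of_nonneg hB]; gcongr
          have b4 : 0 ≤ CH * vnorm q ^ (γ-1) + CtH := by
            have := Real.rpow_nonneg (sc_vnorm_nonneg q) (γ-1)
            have := hH.CtH_pos
            positivity
          gcongr
        rw [Real.norm_eq_abs] at a
        exact (abs_le.1 (a.trans b)).1
      have t3 := sc_Hpp hH y q (B • h)
      rw [sc_vnorm_smul, mul_pow, sq_abs] at t3
      have t4 := sc_scalar hCH hγ (sc_vnorm_nonneg q) (sc_vnorm_nonneg P) hB hh hr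
      have t5 := mul_le_mul_of_nonneg_left t4 (sq_nonneg (vnorm h))
      rw [hm]
      linarith)
  simp only [one_smul, zero_smul, add_zero, neg_smul, Prod.mk_add_mk, Prod.neg_mk, hHH,
    ← sub_eq_add_neg] at h1
  -- convexity in p
  have h2 := sc_convex_1d _ _ _ (sc_line1 (H x) ((sc_H_p_smooth hH x).differentiable (by norm_num)) p p)
    (sc_line2 (H x) (sc_H_p_smooth hH x) p p p) (fun τ => le_trans
      (mul_nonneg (mul_nonneg hCH.le (Real.rpow_nonneg (sc_vnorm_nonneg _) _)) (sq_nonneg _))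
      (sc_Hpp hH x _ p))
    (κ / 2) (by linarith)
  simp only [zero_smul, add_zero] at h2
  rw [show p + (κ / 2) • p = P by rw [hP, add_smul, one_smul], ← sc_dot_grad] at h2
  have h3 := hH.h1 x p
  have h4 : 2 ^ γ * vnorm P ^ γ ≤ 3 ^ γ * vnorm p ^ γ := by
    rw [← Real.mul_rpow (by norm_num) (sc_vnorm_nonneg _),
      ← Real.mul_rpow (by norm_num) (sc_vnorm_nonneg _)]
    refine Real.rpow_le_rpow (mul_nonneg (by norm_num) (sc_vnorm_nonneg _)) ?_ (by linarith)
    rw [hP, sc_vnorm_smul, abs_of_nonneg (by linarith)]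
    have := sc_vnorm_nonneg p
    nlinarith
  have h5 := mul_le_mul_of_nonneg_left h4 (show 0 ≤ vnorm h ^ 2 * (2 * CH) by positivity)
  have h6 := mul_le_mul_of_nonneg_left h3 hκ0
  have h7 : κ * (CH * vnorm p ^ γ - cH) = vnorm h ^ 2 * (2 * CH) * (3 ^ γ * vnorm p ^ γ)
     - vnorm h ^ 2 * (2 * 3 ^ γ * cH) := by rw [hκ]; ring
  rw [h7] at h6
  rw [hm] at h1
  nlinarith

end ham

theorem sc_time {f : ℝ → ℝ} {f' t0 T : ℝ} (hT : t0 < T) (hf : HasDerivAt f f' t0)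
    (hmax : ∀ t ∈ Icc t0 T, f t ≤ f t0) : f' ≤ 0 := by
  have h1 := (hasDerivWithinAt_iff_tendsto_slope' (s := Ioi t0) (by simp)).1
    (hf.hasDerivWithinAt (s := Ioi t0))
  refine le_of_tendsto h1 ?_
  filter_upwards [Ioo_mem_nhdsGT hT] with t ht
  rw [slope_def_field]
  exact div_nonpos_of_nonpos_of_nonneg (by linarith [hmax t ⟨ht.1.le, ht.2.le⟩]) (by linarith [ht.1])

theorem sc_fract {d : ℕ} {α : Type*} (f : Pt d → α) (hp : IsPeriodicF f) (y : Pt d) :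
    f (fun i => Int.fract (y i)) = f y := by
  have := hp (fun i => -⌊y i⌋) y
  rw [← this]
  congr 1
  funext i
  rw [Int.fract]; push_cast; ring

theorem sc_exists_max {d : ℕ} {Y : Type*} [TopologicalSpace Y] (Φ : Pt d → Y → ℝ) (S : Set Y)
    (hS : IsCompact S) (hne : S.Nonempty)
    (hc : ContinuousOn (fun z : Pt d × Y => Φ z.1 z.2) (univ ×ˢ S))
    (hp : ∀ y ∈ S, IsPeriodicF fun x => Φ x y) :
    ∃ x0, ∃ y0 ∈ S, ∀ x, ∀ y ∈ S, Φ x y ≤ Φ x0 y0 := by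
  have hK : IsCompact ((Icc (0 : Pt d) 1) ×ˢ S) := isCompact_Icc.prod hS
  obtain ⟨z, hz, hmax⟩ := hK.exists_isMaxOn
    ((nonempty_Icc.2 (zero_le_one' (Pt d))).prod hne) (hc.mono (prod_mono (subset_univ _) subset_rfl))
  refine ⟨z.1, z.2, hz.2, fun x y hy => ?_⟩
  have := hmax (show ((fun i => Int.fract (x i)), y) ∈ (Icc (0 : Pt d) 1) ×ˢ S from
    ⟨⟨fun i => Int.fract_nonneg _, fun i => (Int.fract_lt_one _).le⟩, hy⟩)
  have e := sc_fract (fun x => Φ x y) (hp y hy) x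
  simp only [mem_ofPred_eq] at this e
  rwa [e] at this

theorem sc_periodic_iter {d : ℕ} (f : Pt d → ℝ) (hp : IsPeriodicF f) (j : ℕ) :
    IsPeriodicF (iteratedFDeriv ℝ j f) := by
  intro k x
  have e : f = fun y => f (y + fun i => (k i : ℝ)) := by
    funext y; exact (hp k y).symm
  conv_rhs => rw [e, iteratedFDeriv_comp_add_right]
  rfl

theorem sc_bounds {d : ℕ} {T α K : ℝ} (hT : 0 < T) (V : Pt d → ℝ → ℝ) (uT : Pt d → ℝ)
    (hVp : ∀ t, IsPeriodicF fun x => V x t) (hV : MemParC T 1 α V)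
    (hup : IsPeriodicF uT) (hu : ContDiff ℝ 2 uT)
    (hK : (∑ j ∈ Finset.range 3, sSup {r | ∃ (x : Pt d) (t : ℝ), t ∈ Icc (0:ℝ) T ∧
          r = ‖iteratedFDeriv ℝ j (fun y => V y t) x‖}) +
        (∑ j ∈ Finset.range 3, sSup {r | ∃ x : Pt d, r = ‖iteratedFDeriv ℝ j uT x‖}) ≤ K) :
    (∀ x, ∀ t ∈ Icc (0:ℝ) T, |V x t| ≤ K) ∧
    (∀ x, ∀ t ∈ Icc (0:ℝ) T, ‖iteratedFDeriv ℝ 2 (fun y => V y t) x‖ ≤ K) ∧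
    (∀ x, |uT x| ≤ K) ∧ (∀ x, ‖iteratedFDeriv ℝ 2 uT x‖ ≤ K) := by
  set a : ℕ → ℝ := fun j => sSup {r | ∃ (x : Pt d) (t : ℝ), t ∈ Icc (0:ℝ) T ∧
          r = ‖iteratedFDeriv ℝ j (fun y => V y t) x‖} with ha
  set b : ℕ → ℝ := fun j => sSup {r | ∃ x : Pt d, r = ‖iteratedFDeriv ℝ j uT x‖} with hb
  have ha0 : ∀ j, 0 ≤ a j := fun j => Real.sSup_nonneg (by rintro r ⟨x, t, _, rfl⟩; exact norm_nonneg _)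
  have hb0 : ∀ j, 0 ≤ b j := fun j => Real.sSup_nonneg (by rintro r ⟨x, rfl⟩; exact norm_nonneg _)
  have hVb : ∀ j ≤ 2, ∀ x, ∀ t ∈ Icc (0:ℝ) T, ‖iteratedFDeriv ℝ j (fun y => V y t) x‖ ≤ a j := by
    intro j hj x t ht
    refine le_csSup ?_ ⟨x, t, ht, rfl⟩
    have hcont := hV.2.2.2.1 0 j (by omega)
    simp only [mixD, iteratedDeriv_zero] at hcont
    obtain ⟨x0, t0, _, hm⟩ := sc_exists_max
      (fun x t => ‖iteratedFDeriv ℝ j (fun y => V y t) x‖) (Icc 0 T) isCompact_Icc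
      (nonempty_Icc.2 hT.le) hcont.norm.continuousOn
      (fun t _ k x => by simp only [sc_periodic_iter _ (hVp t) j k x])
    refine ⟨‖iteratedFDeriv ℝ j (fun y => V y t0) x0‖, ?_⟩
    rintro r ⟨x, t, ht, rfl⟩
    exact hm x t ht
  have hub : ∀ j ≤ 2, ∀ x, ‖iteratedFDeriv ℝ j uT x‖ ≤ b j := by
    intro j hj x
    refine le_csSup ?_ ⟨x, rfl⟩
    have hcont : Continuous (iteratedFDeriv ℝ j uT) :=
      hu.continuous_iteratedFDeriv (by exact_mod_cast hj)
    obtain ⟨x0, t0, _, hm⟩ := sc_exists_max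
      (fun x (_ : ℝ) => ‖iteratedFDeriv ℝ j uT x‖) (Icc 0 T) isCompact_Icc
      (nonempty_Icc.2 hT.le) (hcont.norm.comp continuous_fst).continuousOn
      (fun t _ k x => by simp only [sc_periodic_iter _ hup j k x])
    refine ⟨‖iteratedFDeriv ℝ j uT x0‖, ?_⟩
    rintro r ⟨x, rfl⟩
    exact hm x 0 ⟨le_rfl, hT.le⟩
  simp only [Finset.sum_range_succ, Finset.sum_range_zero, zero_add] at hK
  have h0 := ha0 0
  have h1 := ha0 1
  have h2 := ha0 2
  have h3 := hb0 0
  have h4 := hb0 1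
  have h5 := hb0 2
  refine ⟨fun x t ht => ?_, fun x t ht => ?_, fun x => ?_, fun x => ?_⟩
  · have := hVb 0 (by norm_num) x t ht
    rw [norm_iteratedFDeriv_zero, Real.norm_eq_abs] at this
    linarith
  · have := hVb 2 le_rfl x t ht
    linarith
  · have := hub 0 (by norm_num) x
    rw [norm_iteratedFDeriv_zero, Real.norm_eq_abs] at this
    linarith
  · have := hub 2 le_rfl x
    linarith

/-- First and second order conditions for `a u(x+h) + b u(x-h) + e u(x)` at a maximum. -/
theorem sc_space {d : ℕ} (u : Pt d → ℝ) (hu : ContDiff ℝ 2 u) (a b e : ℝ) (h x0 : Pt d)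
    (hmax : ∀ x, a * u (x + h) + b * u (x - h) + e * u x
      ≤ a * u (x0 + h) + b * u (x0 - h) + e * u x0) :
    (∀ i, a * grad u (x0 + h) i + b * grad u (x0 - h) i + e * grad u x0 i = 0) ∧
    a * lap u (x0 + h) + b * lap u (x0 - h) + e * lap u x0 ≤ 0 := by
  have hd : Differentiable ℝ u := hu.differentiable (by norm_num)
  have h1 : ∀ ξ : Pt d, ∀ τ, HasDerivAt (fun τ : ℝ => a * u ((x0 + h) + τ • ξ)
      + b * u ((x0 - h) + τ • ξ) + e * u (x0 + τ • ξ))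
      (a * fderiv ℝ u ((x0 + h) + τ • ξ) ξ + b * fderiv ℝ u ((x0 - h) + τ • ξ) ξ
        + e * fderiv ℝ u (x0 + τ • ξ) ξ) τ := fun ξ τ =>
    (((sc_line1 u hd (x0 + h) ξ τ).const_mul a).add ((sc_line1 u hd (x0 - h) ξ τ).const_mul b)).add
      ((sc_line1 u hd x0 ξ τ).const_mul e)
  have h2 := fun ξ : Pt d => 
    (((sc_line2 u hu (x0 + h) ξ ξ 0).const_mul a).add
      ((sc_line2 u hu (x0 - h) ξ ξ 0).const_mul b)).add ((sc_line2 u hu x0 ξ ξ 0).const_mul e)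
  have hm : ∀ ξ : Pt d, ∀ τ : ℝ, a * u ((x0 + h) + τ • ξ)
      + b * u ((x0 - h) + τ • ξ) + e * u (x0 + τ • ξ) ≤
      a * u ((x0 + h) + (0:ℝ) • ξ) + b * u ((x0 - h) + (0:ℝ) • ξ) + e * u (x0 + (0:ℝ) • ξ) := by
    intro ξ τ
    have := hmax (x0 + τ • ξ)
    simp only [zero_smul, add_zero]
    rwa [add_right_comm x0 (τ • ξ) h, add_sub_right_comm x0 (τ • ξ) h] at this
  constructor
  · intro i
    have hl : IsLocalMax (fun τ : ℝ => a * u ((x0 + h) + τ • Pi.single i 1)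
      + b * u ((x0 - h) + τ • Pi.single i 1) + e * u (x0 + τ • Pi.single i 1)) 0 :=
      Filter.Eventually.of_forall (hm (Pi.single i 1))
    have := hl.hasDerivAt_eq_zero (h1 (Pi.single i 1) 0)
    simpa [grad] using this
  · unfold lap
    rw [Finset.mul_sum, Finset.mul_sum, Finset.mul_sum, ← Finset.sum_add_distrib,
      ← Finset.sum_add_distrib]
    refine Finset.sum_nonpos fun i _ => ?_
    have := sc_second_1d _ _ _ (h1 (Pi.single i 1)) (h2 (Pi.single i 1)) (hm (Pi.single i 1))
    simp only [sc_iter2]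
    simpa using this

theorem sc_sup {d : ℕ} {s σ T γ cH CH CtH K : ℝ} (hs : s ∈ Set.Ioo (0:ℝ) 1)
    (hK : 0 < K) {H : Pt d → Pt d → ℝ} (hH : HamHypCore d H γ cH CH CtH) (hσ : 0 ≤ σ)
    {V : Pt d → ℝ → ℝ} {uT : Pt d → ℝ} {u : Pt d → ℝ → ℝ}
    (hVK : ∀ x, ∀ t ∈ Icc (0:ℝ) T, |V x t| ≤ K) (huK : ∀ x, |uT x| ≤ K)
    (hu : IsClassicalSolHJB d s σ T H V uT u) (x : Pt d) (t : ℝ) (ht : t ∈ Ioc (0:ℝ) T) :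
    |u x t| ≤ K * (1 + 2 * T) := by
  have key : ∀ a : ℝ, |a| = 1 → a * u x t ≤ K * (1 + 2 * T) := by
    intro a ha
    have haV : ∀ r : ℝ, |r| ≤ K → a * r ≤ K := fun r hr =>
      (le_abs_self _).trans (by rw [abs_mul, ha, one_mul]; exact hr)
    obtain ⟨x0, t0, ht0, hm⟩ := sc_exists_max (fun x t => a * u x t - 2 * K * (T - t)) (Icc t T)
      isCompact_Icc (nonempty_Icc.2 ht.2) (by
        have := hu.cont.mono (prod_mono (subset_refl univ) (Icc_subset_Icc_left ht.1.le))
        fun_prop) (fun t _ k x => by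
          have := hu.per t k x
          simp only at this ⊢
          rw [this])
    have hfin : a * u x0 t0 - 2 * K * (T - t0) ≤ K := by
      rcases ht0.2.eq_or_lt with rfl | hlt
      · rw [hu.final]
        have := haV _ (huK x0)
        linarith
      exfalso
      have ht0' : t0 ∈ Ioo 0 T := ⟨lt_of_lt_of_le ht.1 ht0.1, hlt⟩
      have hx : ∀ x, 0 * u (x + 0) t0 + 0 * u (x - 0) t0 + a * u x t0
          ≤ 0 * u (x0 + 0) t0 + 0 * u (x0 - 0) t0 + a * u x0 t0 := by
        intro x
        have := hm x t0 ht0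
        linarith
      have hf := sc_frac_max hs (fun x => u x t0) (hu.smooth_x t0).continuous (hu.per t0) 0 0 a 0 x0 hx
      obtain ⟨hg, hl⟩ := sc_space (fun x => u x t0) (hu.smooth_x t0) 0 0 a 0 x0 hx
      have ha0 : a ≠ 0 := by rintro rfl; simp at ha
      have hg0 : grad (fun x => u x t0) x0 = 0 := by
        funext i
        have := hg i
        simpa [ha0] using this
      have htd : HasDerivAt (fun t => a * u x0 t - 2 * K * (T - t)) (a * tDeriv u x0 t0 + 2 * K) t0 := by
        have h1 := (hu.diff_t x0 t0 ht0').hasDerivAt.const_mul a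
        have h2 := (((hasDerivAt_id t0).const_sub T)).const_mul (2 * K)
        refine (h1.sub h2).congr_deriv ?_
        simp [tDeriv]
      have htt := sc_time hlt htd (fun t' ht' => hm x0 t' ⟨ht0.1.trans ht'.1, ht'.2⟩)
      have heq := hu.eq x0 t0 ht0'
      rw [hg0, hH.zero] at heq
      have hv := haV _ (hVK x0 t0 ⟨ht0'.1.le, ht0'.2.le⟩)
      rw [← heq] at hv
      have hl' := mul_le_mul_of_nonneg_left hl hσ
      nlinarith
    have := hm x t ⟨le_rfl, ht.2⟩
    have h3 : 0 ≤ K * t := mul_nonneg hK.le ht.1.le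
    linarith
  have h1 := key 1 (by simp)
  have h2 := key (-1) (by simp)
  exact abs_le.2 ⟨by linarith, by linarith⟩

theorem sc_vnorm_single {d : ℕ} (h : Pt d) (i : Fin d) (τ : ℝ) :
    vnorm (h + τ • Pi.single i 1) ^ 2 = vnorm h ^ 2 + 2 * τ * h i + τ ^ 2 := by
  have e : ∀ j, (h + τ • (Pi.single i 1 : Pt d)) j ^ 2
      = h j ^ 2 + (if j = i then 2 * τ * h j + τ ^ 2 else 0) := by
    intro j
    by_cases hj : j = i
    · subst hj; simp; ring
    · simp [hj]
  rw [sc_vnorm_sq, sc_vnorm_sq]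
  simp only [e, Finset.sum_add_distrib, Finset.sum_ite_eq', Finset.mem_univ, if_true]
  ring

theorem sc_vnorm_cont {d : ℕ} : Continuous (fun h : Pt d => vnorm h ^ 2) := by
  simp only [sc_vnorm_sq]; fun_prop

/-- Condition on the gradient from maximality in the increment `h`. -/
theorem sc_hdir {d : ℕ} (u : Pt d → ℝ) (hu : Differentiable ℝ u) (x0 h0 : Pt d) (B : ℝ)
    (hmax : ∀ h, u (x0 + h) + u (x0 - h) - vnorm h ^ 2 * B
      ≤ u (x0 + h0) + u (x0 - h0) - vnorm h0 ^ 2 * B) (i : Fin d) :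
    grad u (x0 + h0) i - grad u (x0 - h0) i = 2 * B * h0 i := by
  set e : Pt d := Pi.single i 1 with he
  have h1 := sc_line1 u hu (x0 + h0) e 0
  have h2 := sc_line1 u hu (x0 - h0) (-e) 0
  have h3 : HasDerivAt (fun τ : ℝ => (vnorm h0 ^ 2 + 2 * τ * h0 i + τ ^ 2) * B)
      (2 * h0 i * B) 0 := by
    have a1 := ((hasDerivAt_id (0:ℝ)).const_mul 2).mul_const (h0 i)
    have a2 := (hasDerivAt_id (0:ℝ)).pow 2
    refine (((a1.const_add (vnorm h0 ^ 2)).add a2).mul_const B).congr_deriv ?_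
    simp
  have h4 := (h1.add h2).sub h3
  have hl : IsLocalMax ((fun t : ℝ => u (x0 + h0 + t • e)) + (fun t : ℝ => u (x0 - h0 + t • -e))
      - fun τ : ℝ => (vnorm h0 ^ 2 + 2 * τ * h0 i + τ ^ 2) * B) 0 := by
    refine Filter.Eventually.of_forall fun τ => ?_
    have := hmax (h0 + τ • e)
    rw [he, sc_vnorm_single, ← he] at this
    have e1 : x0 + (h0 + τ • e) = x0 + h0 + τ • e := by abel
    have e2 : x0 - (h0 + τ • e) = x0 - h0 + τ • -e := by rw [smul_neg]; abel
    rw [e1, e2] at this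
    simpa using this
  have := hl.hasDerivAt_eq_zero h4
  simp only [zero_smul, add_zero, map_neg] at this
  simp only [grad]
  linarith

theorem sc_arith {a1 a2 a3 l1 l2 l3 f1 f2 f3 H1 H2 H3 v1 v2 v3 σ κ n l A B Ct M c K : ℝ}
    (e1 : -a1 - σ * l1 + f1 + H1 = v1) (e2 : -a2 - σ * l2 + f2 + H2 = v2)
    (e3 : -a3 - σ * l3 + f3 + H3 = v3)
    (hham : -(n * (2 * Ct * B + Ct + M * c)) ≤ H1 + H2 - (2 + κ) * H3)
    (hv2 : v1 + v2 - 2 * v3 ≤ K * n) (hv0 : -(κ * v3) ≤ κ * K)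
    (hlap : σ * (1 * l1 + 1 * l2 + (-(2 + κ)) * l3) ≤ 0)
    (hfrac : 0 ≤ 1 * f1 + 1 * f2 + (-(2 + κ)) * f3)
    (htt : a1 + a2 - 2 * a3 - n * (-(l * A) + M * a3) ≤ 0)
    (k1 : κ * K = n * (M * K)) (k2 : n * (M * a3) = κ * a3) :
    n * (l * A) ≤ n * (2 * Ct * B + Ct + M * c + K + M * K) := by
  subst e1 e2 e3
  linarith

set_option maxHeartbeats 1000000 in
theorem sc_main {d : ℕ} {s σ T γ cH CH CtH K : ℝ} (hs : s ∈ Set.Ioo (0:ℝ) 1) (hT : 0 < T)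
    (hK : 0 < K) {H : Pt d → Pt d → ℝ} (hH : HamHypCore d H γ cH CH CtH) (hσ : 0 ≤ σ)
    {V : Pt d → ℝ → ℝ} {uT : Pt d → ℝ} {u : Pt d → ℝ → ℝ}
    (hVC : ∀ t, ContDiff ℝ 2 fun x => V x t) (huC : ContDiff ℝ 2 uT)
    (hVK : ∀ x, ∀ t ∈ Icc (0:ℝ) T, |V x t| ≤ K)
    (hV2 : ∀ x, ∀ t ∈ Icc (0:ℝ) T, ‖iteratedFDeriv ℝ 2 (fun y => V y t) x‖ ≤ K)
    (huK : ∀ x, |uT x| ≤ K) (hu2 : ∀ x, ‖iteratedFDeriv ℝ 2 uT x‖ ≤ K)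
    (hu : IsClassicalSolHJB d s σ T H V uT u) (M U A0 l : ℝ) (hM : M = 2 * 3 ^ γ)
    (hU : U = K * (1 + 2 * T)) (hl : l = 2 * CtH + 1)
    (hA0 : A0 = M * U + 4 * U * (25 + M) + K + 2 * CtH * M * U + CtH + M * cH + M * K + 1)
    (x h : Pt d) (t : ℝ) (ht : t ∈ Ioc (0:ℝ) T) :
    u (x + h) t + u (x - h) t - 2 * u x t
      - vnorm h ^ 2 * (A0 * exp (l * (T - t)) + M * u x t) ≤ 0 := by
  have hCt := hH.CtH_pos
  have hcH := hH.cH_pos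
  have hM0 : 0 < M := by rw [hM]; positivity
  have hU0 : 0 < U := by rw [hU]; positivity
  have hA0p : 0 < A0 := by rw [hA0]; positivity
  have hl0 : 0 < l := by rw [hl]; positivity
  have hsup : ∀ x, ∀ t ∈ Ioc (0:ℝ) T, |u x t| ≤ U := fun x t ht => by
    rw [hU]; exact sc_sup hs hK hH hσ hVK huK hu x t ht
  have hAge : ∀ t ≤ T, A0 ≤ A0 * exp (l * (T - t)) := fun t ht => by
    have : 1 ≤ exp (l * (T - t)) := Real.one_le_exp (mul_nonneg hl0.le (by linarith))
    nlinarith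
  have hMU : ∀ x, ∀ t ∈ Ioc (0:ℝ) T, |M * u x t| ≤ M * U := fun x t ht => by
    rw [abs_mul, abs_of_pos hM0]; exact mul_le_mul_of_nonneg_left (hsup x t ht) hM0.le
  have p1 : 0 < 4 * U * (25 + M) := by positivity
  have p2 : 0 < 2 * CtH * M * U := by positivity
  have p3 : 0 < M * cH := by positivity
  have p4 : 0 < M * K := by positivity
  have p5 : 0 < M * U := by positivity
  have hBge : ∀ x, ∀ t ∈ Ioc (0:ℝ) T,
      4 * U * (25 + M) + K ≤ A0 * exp (l * (T - t)) + M * u x t := fun x t ht => by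
    have h1 := (abs_le.1 (hMU x t ht)).1
    have h2 := hAge t ht.2
    linarith
  by_contra hcon
  push Not at hcon
  -- positive values force small increments
  have hsmall : ∀ (x h : Pt d), ∀ t ∈ Ioc (0:ℝ) T, 0 < u (x + h) t + u (x - h) t - 2 * u x t
      - vnorm h ^ 2 * (A0 * exp (l * (T - t)) + M * u x t) → vnorm h ^ 2 * (25 + M) ≤ 1 := by
    intro x h t ht hpos
    have h1 := (abs_le.1 (hsup (x + h) t ht)).2
    have h2 := (abs_le.1 (hsup (x - h) t ht)).2
    have h3 := (abs_le.1 (hsup x t ht)).1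
    have h4 := hBge x t ht
    have h5 : vnorm h ^ 2 * (4 * U * (25 + M)) ≤
        vnorm h ^ 2 * (A0 * exp (l * (T - t)) + M * u x t) :=
      mul_le_mul_of_nonneg_left (by linarith) (sq_nonneg _)
    have h6 : (4 * U) * (vnorm h ^ 2 * (25 + M)) ≤ (4 * U) * 1 := by linarith
    exact le_of_mul_le_mul_left h6 (by positivity)
  have hball : ∀ h : Pt d, vnorm h ^ 2 * (25 + M) ≤ 1 → vnorm h ≤ 1 / 5 := by
    intro h hh
    have : 0 ≤ vnorm h ^ 2 * M := by positivity
    have h0 := sc_vnorm_nonneg h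
    nlinarith
  set Ψ : Pt d → Pt d × ℝ → ℝ := fun x y => u (x + y.1) y.2 + u (x - y.1) y.2 - 2 * u x y.2
      - vnorm y.1 ^ 2 * (A0 * exp (l * (T - y.2)) + M * u x y.2) with hΨ
  set S : Set (Pt d × ℝ) := Metric.closedBall (0 : Pt d) 1 ×ˢ Icc t T with hS
  have hmemS : ∀ (h : Pt d) (t' : ℝ), t' ∈ Icc t T → vnorm h ^ 2 * (25 + M) ≤ 1 → (h, t') ∈ S := by
    intro h t' ht' hh
    refine ⟨?_, ht'⟩
    rw [mem_closedBall_zero_iff]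
    have := hball h hh
    have := sc_norm_le_vnorm h
    linarith
  obtain ⟨x0, ⟨h0, t0⟩, hy0, hm⟩ := sc_exists_max Ψ S
    ((isCompact_closedBall _ _).prod isCompact_Icc)
    ⟨(h, t), hmemS h t ⟨le_rfl, ht.2⟩ (hsmall x h t ht hcon)⟩ (by
      have hc1 : ContinuousOn (fun z : Pt d × (Pt d × ℝ) => u (z.1 + z.2.1) z.2.2) (univ ×ˢ S) :=
        hu.cont.comp (f := fun z : Pt d × (Pt d × ℝ) => (z.1 + z.2.1, z.2.2)) (by fun_prop)
          (fun z hz => ⟨mem_univ _, ht.1.le.trans hz.2.2.1, hz.2.2.2⟩)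
      have hc2 : ContinuousOn (fun z : Pt d × (Pt d × ℝ) => u (z.1 - z.2.1) z.2.2) (univ ×ˢ S) :=
        hu.cont.comp (f := fun z : Pt d × (Pt d × ℝ) => (z.1 - z.2.1, z.2.2)) (by fun_prop)
          (fun z hz => ⟨mem_univ _, ht.1.le.trans hz.2.2.1, hz.2.2.2⟩)
      have hc3 : ContinuousOn (fun z : Pt d × (Pt d × ℝ) => u z.1 z.2.2) (univ ×ˢ S) :=
        hu.cont.comp (f := fun z : Pt d × (Pt d × ℝ) => (z.1, z.2.2)) (by fun_prop)
          (fun z hz => ⟨mem_univ _, ht.1.le.trans hz.2.2.1, hz.2.2.2⟩)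
      have hc4 : ContinuousOn (fun z : Pt d × (Pt d × ℝ) => vnorm z.2.1 ^ 2) (univ ×ˢ S) :=
        (sc_vnorm_cont.comp (continuous_fst.comp continuous_snd)).continuousOn
      have hc5 : ContinuousOn (fun z : Pt d × (Pt d × ℝ) => A0 * exp (l * (T - z.2.2)))
          (univ ×ˢ S) := by fun_prop
      exact ((hc1.add hc2).sub (hc3.const_mul 2)).sub (hc4.mul (hc5.add (hc3.const_mul M)))) (by
      rintro ⟨y, r⟩ _ k x
      have e1 := hu.per r k (x + y)
      have e2 := hu.per r k (x - y)
      have e3 := hu.per r k x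
      have f1 : (fun i => x i + (k i : ℝ)) + y = fun i => (x + y) i + (k i : ℝ) := by
        funext i; simp only [Pi.add_apply]; ring
      have f2 : (fun i => x i + (k i : ℝ)) - y = fun i => (x - y) i + (k i : ℝ) := by
        funext i; simp only [Pi.sub_apply]; ring
      simp only [hΨ, f1, f2]
      simp only at e1 e2 e3
      rw [e1, e2, e3])
  have ht0I : t0 ∈ Icc t T := hy0.2
  have ht0 : t0 ∈ Ioc (0:ℝ) T := ⟨lt_of_lt_of_le ht.1 ht0I.1, ht0I.2⟩
  have hpos : 0 < Ψ x0 (h0, t0) :=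
    lt_of_lt_of_le hcon (hm x (h, t) (hmemS h t ⟨le_rfl, ht.2⟩ (hsmall x h t ht hcon)))
  -- the maximum is global in the increment
  have hglob : ∀ (x h : Pt d), ∀ t' ∈ Icc t T, Ψ x (h, t') ≤ Ψ x0 (h0, t0) := by
    intro x h t' ht'
    rcases le_or_gt (Ψ x (h, t')) 0 with hle | hgt
    · linarith
    · exact hm x (h, t') (hmemS h t' ht' (hsmall x h t' ⟨lt_of_lt_of_le ht.1 ht'.1, ht'.2⟩ hgt))
  have hsm := hsmall x0 h0 t0 ht0 hpos
  have hh5 := hball h0 hsm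
  set n2 := vnorm h0 ^ 2 with hn2
  have hn20 : 0 ≤ n2 := sq_nonneg _
  set A := A0 * exp (l * (T - t0)) with hA
  set B := A + M * u x0 t0 with hB
  have hBg : 4 * U * (25 + M) + K ≤ B := hBge x0 t0 ht0
  have hB0 : 0 ≤ B := by linarith
  have hpos' : 0 < u (x0 + h0) t0 + u (x0 - h0) t0 - 2 * u x0 t0 - n2 * B := hpos
  have hh0 : h0 ≠ 0 := by
    rintro rfl
    rw [add_zero, sub_zero] at hpos'
    have : 0 ≤ n2 * B := mul_nonneg hn20 hB0
    linarith
  have hn2p : 0 < n2 := by have := sc_vnorm_pos h0 hh0; positivity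
  rcases ht0I.2.eq_or_lt with hTe | hlt
  · -- terminal time
    have := sc_diff2_le uT huC K hu2 x0 h0
    rw [hTe, hu.final, hu.final, hu.final] at hpos'
    have h2 : n2 * K ≤ n2 * B := mul_le_mul_of_nonneg_left (by linarith) hn20
    linarith
  -- interior time
  have ht0' : t0 ∈ Ioo 0 T := ⟨ht0.1, hlt⟩
  set κ := M * n2 with hκ
  have hκ0 : 0 ≤ κ := by positivity
  have hx : ∀ x, 1 * u (x + h0) t0 + 1 * u (x - h0) t0 + (-(2 + κ)) * u x t0
      ≤ 1 * u (x0 + h0) t0 + 1 * u (x0 - h0) t0 + (-(2 + κ)) * u x0 t0 := by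
    intro x
    have := hglob x h0 t0 ht0I
    simp only [hΨ] at this
    rw [hκ]
    linarith
  have hfrac := sc_frac_max hs (fun x => u x t0) (hu.smooth_x t0).continuous (hu.per t0) 1 1
    (-(2 + κ)) h0 x0 hx
  obtain ⟨hg, hlap⟩ := sc_space (fun x => u x t0) (hu.smooth_x t0) 1 1 (-(2 + κ)) h0 x0 hx
  have hhd := sc_hdir (fun x => u x t0) ((hu.smooth_x t0).differentiable (by norm_num)) x0 h0 B
    (by
      intro h
      have := hglob x0 h t0 ht0I
      simp only [hΨ] at this
      linarith)
  set p := grad (fun x => u x t0) x0 with hp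
  have hpp : grad (fun x => u x t0) (x0 + h0) = (1 + κ / 2) • p + B • h0 := by
    funext i
    have h1 := hg i
    have h2 := hhd i
    simp only [Pi.add_apply, Pi.smul_apply, smul_eq_mul]
    linarith
  have hpm : grad (fun x => u x t0) (x0 - h0) = (1 + κ / 2) • p - B • h0 := by
    funext i
    have h1 := hg i
    have h2 := hhd i
    simp only [Pi.sub_apply, Pi.smul_apply, smul_eq_mul]
    linarith
  have hham := sc_ham hH x0 h0 p B κ hB0 (by rw [hκ, hM]) (by linarith) hh5
  have htd : HasDerivAt (fun r => Ψ x0 (h0, r)) (tDeriv u (x0 + h0) t0 + tDeriv u (x0 - h0) t0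
      - 2 * tDeriv u x0 t0 - n2 * (-(l * A) + M * tDeriv u x0 t0)) t0 := by
    have d1 := (hu.diff_t (x0 + h0) t0 ht0').hasDerivAt
    have d2 := (hu.diff_t (x0 - h0) t0 ht0').hasDerivAt
    have d3 := (hu.diff_t x0 t0 ht0').hasDerivAt
    have d4 : HasDerivAt (fun r => A0 * exp (l * (T - r))) (-(l * A)) t0 := by
      have := ((((hasDerivAt_id t0).const_sub T).const_mul l).exp).const_mul A0
      refine this.congr_deriv ?_
      simp [hA]; ring
    exact ((d1.add d2).sub (d3.const_mul 2)).sub ((d4.add (d3.const_mul M)).const_mul n2)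
  have htt := sc_time hlt htd (fun t' ht' => hglob x0 h0 t' ⟨ht0I.1.trans ht'.1, ht'.2⟩)
  have e1 := hu.eq (x0 + h0) t0 ht0'
  have e2 := hu.eq (x0 - h0) t0 ht0'
  have e3 := hu.eq x0 t0 ht0'
  rw [hpp] at e1
  rw [hpm] at e2
  rw [← hp] at e3
  have hIcc : t0 ∈ Icc (0:ℝ) T := ⟨ht0'.1.le, ht0'.2.le⟩
  have hv2 := sc_diff2_le (fun x => V x t0) (hVC t0) K (fun x => hV2 x t0 hIcc) x0 h0
  have hv0 : -(κ * V x0 t0) ≤ κ * K := by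
    have := (abs_le.1 (hVK x0 t0 hIcc)).1
    nlinarith
  have hlap' : σ * (1 * lap (fun x => u x t0) (x0 + h0) + 1 * lap (fun x => u x t0) (x0 - h0)
      + (-(2 + κ)) * lap (fun x => u x t0) x0) ≤ 0 := mul_nonpos_of_nonneg_of_nonpos hσ hlap
  have hfin : n2 * (l * A) ≤ n2 * (2 * CtH * B + CtH + M * cH + K + M * K) := by
    rw [← hM, ← hn2] at hham
    rw [← hn2] at hv2
    have k1 : κ * K = n2 * (M * K) := by rw [hκ]; ring
    have k2 : n2 * (M * tDeriv u x0 t0) = κ * tDeriv u x0 t0 := by rw [hκ]; ring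
    exact sc_arith e1 e2 e3 hham hv2 hv0 hlap' hfrac htt k1 k2
  have hfin' := le_of_mul_le_mul_left hfin hn2p
  have hAA : A0 ≤ A := hAge t0 ht0.2
  have hBA : B ≤ A + M * U := by
    have := (abs_le.1 (hMU x0 t0 ht0)).2
    linarith
  have hCB : 2 * CtH * B ≤ 2 * CtH * (A + M * U) := mul_le_mul_of_nonneg_left hBA (by linarith)
  rw [hl] at hfin'
  linarith

theorem sc_finish {d : ℕ} (f : Pt d → ℝ) (hf : ContDiff ℝ 2 f) (C : ℝ) (x : Pt d)
    (hC : ∀ h, f (x + h) + f (x - h) - 2 * f x ≤ C * vnorm h ^ 2) (ξ : Pt d) :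
    iteratedFDeriv ℝ 2 f x (fun _ => ξ) ≤ C * vnorm ξ ^ 2 := by
  have hd : Differentiable ℝ f := hf.differentiable (by norm_num)
  have h1 : ∀ τ : ℝ, HasDerivAt (fun τ : ℝ => f (x + τ • ξ) + f (x + τ • -ξ)
      - C * vnorm ξ ^ 2 * τ ^ 2) (fderiv ℝ f (x + τ • ξ) ξ + fderiv ℝ f (x + τ • -ξ) (-ξ)
      - C * vnorm ξ ^ 2 * (2 * τ)) τ := fun τ => by
    have := ((sc_line1 f hd x ξ τ).add (sc_line1 f hd x (-ξ) τ)).sub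
      (((hasDerivAt_id τ).pow 2).const_mul (C * vnorm ξ ^ 2))
    refine this.congr_deriv ?_
    simp
  have h2 := ((sc_line2 f hf x ξ ξ 0).add (sc_line2 f hf x (-ξ) (-ξ) 0)).sub
      (((hasDerivAt_id (0:ℝ)).const_mul 2).const_mul (C * vnorm ξ ^ 2))
  have := sc_second_1d _ _ _ h1 h2 (fun τ => by
    have := hC (τ • ξ)
    rw [sc_vnorm_smul, mul_pow, sq_abs] at this
    simp only [smul_neg, ← sub_eq_add_neg, zero_smul, add_zero, neg_zero]
    linarith)
  rw [sc_iter2]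
  simp only [zero_smul, add_zero, map_neg, neg_neg, mul_one, neg_apply] at this
  linarith

/-- Semiconcavity estimate, uniform in the viscosity `σ ≥ 0`, for
classical solutions of the backward fractional HJB equation, under hypotheses (H1),
(H3)-(H5) on `H` and a bound `‖V‖_{C²_x(Q_T)} + ‖u_T‖_{C²(𝕋^d)} ≤ K`:
`D²u(x,t) ≤ C·I` on `Q_T`, with `C` depending only on `K`. -/
theorem semiconcavity_estimate (d : ℕ) (s T α γ cH CH CtH K : ℝ)
    (hs : s ∈ Set.Ioo (0:ℝ) 1) (hT : 0 < T) (hα : α ∈ Set.Ioo (0:ℝ) 1) (hK : 0 < K)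
    (H : Pt d → Pt d → ℝ) (hH : HamHypCore d H γ cH CH CtH) :
    ∃ C > 0, ∀ (σ : ℝ) (V : Pt d → ℝ → ℝ) (uT : Pt d → ℝ) (u : Pt d → ℝ → ℝ),
      0 ≤ σ →
      -- `V ∈ C^{2+α,1+α/2}(Q_T)`, periodic in space
      (∀ t, IsPeriodicF fun x => V x t) → MemParC T 1 α V →
      IsPeriodicF uT → ContDiff ℝ 2 uT →
      -- `‖V‖_{C²_x(Q_T)} + ‖u_T‖_{C²(𝕋^d)} ≤ K`
      (∑ j ∈ Finset.range 3, sSup {r | ∃ (x : Pt d) (t : ℝ), t ∈ Icc (0:ℝ) T ∧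
          r = ‖iteratedFDeriv ℝ j (fun y => V y t) x‖}) +
        (∑ j ∈ Finset.range 3, sSup {r | ∃ x : Pt d, r = ‖iteratedFDeriv ℝ j uT x‖}) ≤ K →
      IsClassicalSolHJB d s σ T H V uT u →
      -- semiconcavity: `D²u(x,t) ξ·ξ ≤ C|ξ|²` on `Q_T`
      ∀ (x : Pt d), ∀ t ∈ Icc (0:ℝ) T, ∀ ξ : Pt d,
        iteratedFDeriv ℝ 2 (fun y => u y t) x (fun _ => ξ) ≤ C * vnorm ξ ^ 2 := by
  have hcH := hH.cH_pos
  have hCt := hH.CtH_pos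
  set M : ℝ := 2 * 3 ^ γ with hM
  set U : ℝ := K * (1 + 2 * T) with hU
  set l : ℝ := 2 * CtH + 1 with hl
  set A0 : ℝ := M * U + 4 * U * (25 + M) + K + 2 * CtH * M * U + CtH + M * cH + M * K + 1 with hA0
  have hM0 : 0 < M := by rw [hM]; positivity
  have hU0 : 0 < U := by rw [hU]; positivity
  have hA0p : 0 < A0 := by rw [hA0]; positivity
  have hl0 : 0 < l := by rw [hl]; positivity
  refine ⟨A0 * exp (l * T) + M * U, by positivity, ?_⟩
  intro σ V uT u hσ hVp hV huTp huTC hKK hu x t ht ξ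
  obtain ⟨b1, b2, b3, b4⟩ := sc_bounds hT V uT hVp hV huTp huTC hKK
  have hVC : ∀ t, ContDiff ℝ 2 fun x => V x t := fun t => by simpa using hV.1 t
  have hpos : ∀ t ∈ Ioc (0:ℝ) T, ∀ h : Pt d, u (x + h) t + u (x - h) t - 2 * u x t
      ≤ (A0 * exp (l * T) + M * U) * vnorm h ^ 2 := by
    intro t ht h
    have h1 := sc_main hs hT hK hH hσ hVC huTC b1 b2 b3 b4 hu M U A0 l hM hU hl hA0 x h t ht
    have h2 : u x t ≤ U := (abs_le.1 (sc_sup hs hK hH hσ b1 b3 hu x t ht)).2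
    have h3 : exp (l * (T - t)) ≤ exp (l * T) :=
      Real.exp_le_exp.2 (mul_le_mul_of_nonneg_left (by linarith [ht.1]) hl0.le)
    have h4 : A0 * exp (l * (T - t)) + M * u x t ≤ A0 * exp (l * T) + M * U :=
      add_le_add (mul_le_mul_of_nonneg_left h3 hA0p.le) (mul_le_mul_of_nonneg_left h2 hM0.le)
    have h5 := mul_le_mul_of_nonneg_left h4 (sq_nonneg (vnorm h))
    linarith
  refine sc_finish (fun y => u y t) (hu.smooth_x t) _ x (fun h => ?_) ξ
  rcases ht.1.eq_or_lt with h0 | h0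
  swap
  · exact hpos t ⟨h0, ht.2⟩ h
  subst h0
  have hc : ∀ z : Pt d, Tendsto (fun r => u z r) (𝓝[>] 0) (𝓝 (u z 0)) := by
    intro z
    have h1 : ContinuousOn (fun r : ℝ => u z r) (Icc 0 T) :=
      hu.cont.comp (f := fun r : ℝ => (z, r)) (by fun_prop) (fun r hr => ⟨mem_univ _, hr⟩)
    have h2 := (h1 0 ⟨le_rfl, hT.le⟩).mono Ioc_subset_Icc_self
    have h3 : 𝓝[Ioc 0 T] (0:ℝ) = 𝓝[>] 0 := nhdsWithin_Ioc_eq_nhdsGT hT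
    rw [← h3]
    exact h2
  refine le_of_tendsto (((hc (x + h)).add (hc (x - h))).sub ((hc x).const_mul 2)) ?_
  filter_upwards [Ioc_mem_nhdsGT hT] with r hr
  exact hpos r hr h
end
end
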